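/- arXiv:1205.4674 — 9 statements merged into one kernel-verified Lean document; each statement's English description precedes it below -/
import Mathlib

section
/- Let g(z) = 2H_b(z)/(3+z). For z ∈ (0,1), g'(z) = 0 if and only if (1-z)⁸ = z⁶. -/
/-- The binary entropy function (base-2), with the convention `0 · log 0 = 0`. -/
noncomputable def binEnt (x : ℝ) : ℝ :=
  -(x * Real.logb 2 x) - (1 - x) * Real.logb 2 (1 - x)

theorem hasDerivAt_binEnt {z : ℝ} (h0 : 0 < z) (h1 : z < 1) :
    HasDerivAt binEnt ((Real.log (1 - z) - Real.log z) / Real.log 2) z := by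
  have h1' : 1 - z ≠ 0 := (sub_pos.2 h1).ne'
  have hid : HasDerivAt (fun x : ℝ => 1 - x) (-1) z := (hasDerivAt_id z).const_sub 1
  have hA := (hasDerivAt_id z).mul ((Real.hasDerivAt_log h0.ne').div_const (Real.log 2))
  have hB := hid.mul ((hid.log h1').div_const (Real.log 2))
  have hlog2 : Real.log 2 ≠ 0 := (Real.log_pos one_lt_two).ne'
  refine (hA.neg.sub hB).congr_deriv ?_
  simp only [id_eq]
  field_simp
  ring

theorem ising_rate_critical_points (z : ℝ) (hz : z ∈ Set.Ioo (0 : ℝ) 1) :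
    deriv (fun z : ℝ => 2 * binEnt z / (3 + z)) z = 0 ↔ (1 - z) ^ 8 = z ^ 6 := by
  obtain ⟨h0, h1⟩ := hz
  have h1' : 0 < 1 - z := sub_pos.2 h1
  have h3 : 3 + z ≠ 0 := by positivity
  have hlog2 : Real.log 2 ≠ 0 := (Real.log_pos one_lt_two).ne'
  have hd : HasDerivAt (fun z : ℝ => 2 * binEnt z / (3 + z))
      (2 * (4 * Real.log (1 - z) - 3 * Real.log z) / (Real.log 2 * (3 + z) ^ 2)) z := by
    refine (((hasDerivAt_binEnt h0 h1).const_mul 2).div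
      ((hasDerivAt_id z).const_add 3) h3).congr_deriv ?_
    simp only [binEnt, Real.logb, id_eq]
    field_simp
    ring
  have hden : Real.log 2 * (3 + z) ^ 2 ≠ 0 := mul_ne_zero hlog2 (pow_ne_zero 2 h3)
  have hpow : (1 - z) ^ 8 = z ^ 6 ↔ Real.log ((1 - z) ^ 8) = Real.log (z ^ 6) :=
    (Real.log_injOn_pos.eq_iff (pow_pos h1' 8) (pow_pos h0 6)).symm
  rw [hd.deriv, hpow, Real.log_pow, Real.log_pow, div_eq_zero_iff, or_iff_left hden]
  push_cast
  constructor <;> intro h <;> linarith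
end

section
/- Let g(z) = 2H_b(z)/(3+z) and let a be the unique root in (0,1) of the polynomial x⁴ - 5x³ + 6x² - 4x + 1. Then g'(z) > 0 for all z ∈ (0,a) and g'(z) < 0 for all z ∈ (a,1). -/
theorem binEnt_eq_binEntropy_div_log_two (x : ℝ) :
    binEnt x = Real.binEntropy x / Real.log 2 := by
  simp only [binEnt, Real.binEntropy, Real.logb, Real.log_inv]
  ring

theorem deriv_two_mul_binEnt_div_three_add {z : ℝ} (hz : z ∈ Set.Ioo (0 : ℝ) 1) :
    deriv (fun z : ℝ => 2 * binEnt z / (3 + z)) z =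
      2 * (Real.log ((1 - z) ^ 4) - Real.log (z ^ 3)) / (Real.log 2 * (3 + z) ^ 2) := by
  obtain ⟨hz0, hz1⟩ := hz
  have hlog : Real.log 2 ≠ 0 := (Real.log_pos one_lt_two).ne'
  have hden : 3 + z ≠ 0 := by positivity
  have hderiv := (((Real.hasDerivAt_binEntropy hz0.ne' hz1.ne).div_const
    (Real.log 2)).const_mul 2).fun_div ((hasDerivAt_id' z).const_add 3) hden
  simp only [binEnt_eq_binEntropy_div_log_two]
  rw [hderiv.deriv]
  simp only [Real.binEntropy, Real.log_inv, Real.log_pow]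
  field_simp
  push_cast
  ring

theorem ising_rate_monotonicity (a : ℝ) (ha : a ∈ Set.Ioo (0 : ℝ) 1)
    (haroot : a ^ 4 - 5 * a ^ 3 + 6 * a ^ 2 - 4 * a + 1 = 0)
    (hauniq : ∀ x ∈ Set.Ioo (0 : ℝ) 1,
      x ^ 4 - 5 * x ^ 3 + 6 * x ^ 2 - 4 * x + 1 = 0 → x = a) :
    (∀ z ∈ Set.Ioo (0 : ℝ) a, 0 < deriv (fun z : ℝ => 2 * binEnt z / (3 + z)) z) ∧
      (∀ z ∈ Set.Ioo a (1 : ℝ), deriv (fun z : ℝ => 2 * binEnt z / (3 + z)) z < 0) := by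
  obtain ⟨ha0, ha1⟩ := ha
  have heq : (1 - a) ^ 4 = a ^ 3 := by linear_combination haroot
  have hlog : 0 < Real.log 2 := Real.log_pos one_lt_two
  refine ⟨fun z ⟨hz0, hza⟩ => ?_, fun z ⟨haz, hz1⟩ => ?_⟩
  · rw [deriv_two_mul_binEnt_div_three_add ⟨hz0, hza.trans ha1⟩]
    have hlt : z ^ 3 < (1 - z) ^ 4 := calc
      z ^ 3 < a ^ 3 := by gcongr
      _ = (1 - a) ^ 4 := heq.symm
      _ < (1 - z) ^ 4 := pow_lt_pow_left₀ (by linarith) (by linarith) (by norm_num)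
    have hdiff := sub_pos.2 (Real.log_lt_log (by positivity) hlt)
    positivity
  · have hz0 : 0 < z := ha0.trans haz
    rw [deriv_two_mul_binEnt_div_three_add ⟨hz0, hz1⟩]
    have hlt : (1 - z) ^ 4 < z ^ 3 := calc
      (1 - z) ^ 4 < (1 - a) ^ 4 := pow_lt_pow_left₀ (by linarith) (by linarith) (by norm_num)
      _ = a ^ 3 := heq
      _ < z ^ 3 := by gcongr
    have hdiff := sub_neg.2 (Real.log_lt_log (pow_pos (sub_pos.2 hz1) 4) hlt)
    exact div_neg_of_neg_of_pos (by linarith) (by positivity)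
end

section
/- Let a be the unique root in (0,1) of the polynomial x⁴ - 5x³ + 6x² - 4x + 1. Then for all z ∈ [0,1], 2H_b(z)/(3+z) ≤ 2H_b(a)/(3+a), with equality only at z = a; i.e., a = argmax over [0,1] of z ↦ 2H_b(z)/(3+z), and the maximum value equals 2H_b(a)/(3+a). -/
/-- The pointwise inequality behind Gibbs' inequality, in strict form. -/
lemma mul_log_sub_mul_log_lt_sub {a z : ℝ} (ha : 0 < a) (hz : 0 ≤ z) (hza : z ≠ a) :
    z * Real.log a - z * Real.log z < a - z := by
  rcases hz.eq_or_lt with rfl | hz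
  · simpa using ha
  · have hne : a / z ≠ 1 := fun h => hza ((div_eq_one_iff_eq hz.ne').1 h).symm
    have hlog := Real.log_lt_sub_one_of_pos (div_pos ha hz) hne
    rw [Real.log_div ha.ne' hz.ne'] at hlog
    have hmul := mul_lt_mul_of_pos_left hlog hz
    have hcancel : z * (a / z - 1) = a - z := by field_simp
    linarith

/-- Gibbs' inequality for two distinct Bernoulli distributions. -/
lemma binEnt_lt_crossEntropy {a z : ℝ} (ha : a ∈ Set.Ioo (0 : ℝ) 1)
    (hz : z ∈ Set.Icc (0 : ℝ) 1) (hza : z ≠ a) :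
    binEnt z < -(z * Real.logb 2 a) - (1 - z) * Real.logb 2 (1 - a) := by
  have h₁ := mul_log_sub_mul_log_lt_sub ha.1 hz.1 hza
  have h₂ := mul_log_sub_mul_log_lt_sub (sub_pos.2 ha.2) (sub_nonneg.2 hz.2)
    (fun h => hza (sub_right_injective h))
  have hlog2 : 0 < Real.log 2 := Real.log_pos one_lt_two
  have hlt : -(z * Real.log z) - (1 - z) * Real.log (1 - z) <
      -(z * Real.log a) - (1 - z) * Real.log (1 - a) := by linarith
  have hdiv := div_lt_div_of_pos_right hlt hlog2
  simp only [binEnt, Real.logb]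
  ring_nf at hdiv ⊢
  exact hdiv

theorem ising_rate_maximum (a : ℝ) (ha : a ∈ Set.Ioo (0 : ℝ) 1)
    (haroot : a ^ 4 - 5 * a ^ 3 + 6 * a ^ 2 - 4 * a + 1 = 0)
    (hauniq : ∀ x ∈ Set.Ioo (0 : ℝ) 1,
      x ^ 4 - 5 * x ^ 3 + 6 * x ^ 2 - 4 * x + 1 = 0 → x = a) :
    (∀ z ∈ Set.Icc (0 : ℝ) 1, 2 * binEnt z / (3 + z) ≤ 2 * binEnt a / (3 + a)) ∧
      (∀ z ∈ Set.Icc (0 : ℝ) 1,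
        2 * binEnt z / (3 + z) = 2 * binEnt a / (3 + a) → z = a) := by
  have hlog : 4 * Real.logb 2 (1 - a) = 3 * Real.logb 2 a := by
    have hpow : (1 - a) ^ 4 = a ^ 3 := by linear_combination haroot
    simpa [Real.logb_pow] using congrArg (Real.logb 2) hpow
  have hcross : ∀ z : ℝ, -(z * Real.logb 2 a) - (1 - z) * Real.logb 2 (1 - a) =
      -(Real.logb 2 a / 4) * (3 + z) := fun z => by
    linear_combination (-(1 - z) / 4) * hlog
  have hmax : 2 * binEnt a / (3 + a) = 2 * -(Real.logb 2 a / 4) := by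
    have hpos : 3 + a ≠ 0 := by linarith [ha.1]
    rw [binEnt, hcross a]
    field_simp
  have hlt : ∀ z ∈ Set.Icc (0 : ℝ) 1, z ≠ a →
      2 * binEnt z / (3 + z) < 2 * binEnt a / (3 + a) := fun z hz hza => by
    have hgibbs := binEnt_lt_crossEntropy ha hz hza
    rw [hcross z] at hgibbs
    rw [hmax, div_lt_iff₀ (by linarith [hz.1])]
    linarith
  refine ⟨fun z hz => ?_, fun z hz heq => ?_⟩
  · rcases eq_or_ne z a with rfl | hza
    · exact le_rfl
    · exact (hlt z hz hza).le
  · by_contra hza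
    exact (hlt z hz hza).ne heq
end

section
/- For every x ∈ (0,1), the equation 4H_b(x)/(3+x) + log₂ x = 0 holds if and only if x⁴ - 5x³ + 6x² - 4x + 1 = 0 (equivalently, if and only if x³ = (1-x)⁴). -/
/-- Clearing the denominator `3 + x` factors the left-hand side through `1 - x`. -/
theorem four_mul_binEnt_div_add_logb {x : ℝ} (hx : 3 + x ≠ 0) :
    4 * binEnt x / (3 + x) + Real.logb 2 x =
      (1 - x) * (Real.logb 2 (x ^ 3) - Real.logb 2 ((1 - x) ^ 4)) / (3 + x) := by
  rw [Real.logb_pow, Real.logb_pow, binEnt]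
  field_simp
  push_cast
  ring

theorem ising_stationarity_condition (x : ℝ) (hx : x ∈ Set.Ioo (0 : ℝ) 1) :
    (4 * binEnt x / (3 + x) + Real.logb 2 x = 0 ↔
      x ^ 4 - 5 * x ^ 3 + 6 * x ^ 2 - 4 * x + 1 = 0) ∧
    (4 * binEnt x / (3 + x) + Real.logb 2 x = 0 ↔ x ^ 3 = (1 - x) ^ 4) := by
  obtain ⟨hx0, hx1⟩ := hx
  have h3 : 3 + x ≠ 0 := by positivity
  have h1 : 0 < 1 - x := sub_pos.mpr hx1
  have key : 4 * binEnt x / (3 + x) + Real.logb 2 x = 0 ↔ x ^ 3 = (1 - x) ^ 4 := by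
    rw [four_mul_binEnt_div_add_logb h3, div_eq_zero_iff, or_iff_left h3, mul_eq_zero,
      or_iff_right h1.ne', sub_eq_zero]
    exact (Real.logb_injOn_pos one_lt_two).eq_iff (pow_pos hx0 3) (pow_pos h1 4)
  refine ⟨key.trans ?_, key⟩
  constructor <;> intro h <;> linear_combination -h
end

section
/- The function h* : [0,1] → ℝ is continuous and concave on [0,1]. -/
/-- The right-interval branch of the function `h*` solving the Bellman equation. -/
noncomputable def Bbranch (a ρ z : ℝ) : ℝ :=
  (1 / (1 - a)) * binEnt ((2 * a + (1 - a) * z) / 2) - z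
    + ((a * z - 4 * a - z) / (2 * (1 - a))) * ρ
    + ((2 * a + (1 - a) * z) / (2 * (1 - a))) * binEnt (2 * a / (a * (2 - z) + z))

/-- The function `h*` solving the Bellman equation: `h*(z) = H_b(z)` on
`[(1-a)/(1+a), 2a/(1+a)]`, the branch `Bbranch` on `[2a/(1+a), 1]`, and
`h*(z) = h*(1-z)` on `[0, (1-a)/(1+a)]` (where `1-z ∈ [2a/(1+a), 1]`). -/
noncomputable def hStar (a ρ z : ℝ) : ℝ :=
  if z < (1 - a) / (1 + a) then Bbranch a ρ (1 - z)
  else if z ≤ 2 * a / (1 + a) then binEnt z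
  else Bbranch a ρ z

/-- The Bellman-operator objective `g_z(δ, γ)` (restricted to the policy `(δ, γ)`),
for the function `h*`. Since division by zero is zero in Lean, any term whose
coefficient vanishes is automatically `0`, matching the stated convention. -/
noncomputable def gObj (a ρ z δ γ : ℝ) : ℝ :=
  binEnt (1 / 2 + (δ - γ) / 2) + δ + γ - 1
    + ((1 + δ - γ) / 2) * hStar a ρ (1 + (δ - z) / (1 + δ - γ))
    + ((1 - δ + γ) / 2) * hStar a ρ ((1 - z - γ) / (1 + γ - δ))

open Real Set

/-- Gluing two functions along a point where they agree preserves differentiability, provided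
that both have the prescribed derivative wherever they are relevant. -/
theorem hasDerivAt_ite_le {f g : ℝ → ℝ} {c d x : ℝ} (hfg : f c = g c)
    (hf : x ≤ c → HasDerivAt f d x) (hg : c ≤ x → HasDerivAt g d x) :
    HasDerivAt (fun y => if y ≤ c then f y else g y) d x := by
  rcases lt_trichotomy x c with h | h | h
  · refine (hf h.le).congr_of_eventuallyEq ?_
    filter_upwards [Iio_mem_nhds h] with y hy
    exact if_pos (le_of_lt hy)
  · subst h
    have h₁ : HasDerivWithinAt (fun y => if y ≤ x then f y else g y) d (Iic x) x :=
      (hf le_rfl).hasDerivWithinAt.congr (fun y hy => if_pos hy) (if_pos le_rfl)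
    have h₂ : HasDerivWithinAt (fun y => if y ≤ x then f y else g y) d (Ici x) x := by
      refine (hg le_rfl).hasDerivWithinAt.congr (fun y hy => ?_) (by simp [hfg])
      rcases eq_or_lt_of_le (mem_Ici.1 hy) with rfl | hy
      · simp [hfg]
      · exact if_neg hy.not_ge
    simpa [Iic_union_Ici] using h₁.union h₂
  · refine (hg h.le).congr_of_eventuallyEq ?_
    filter_upwards [Ioi_mem_nhds h] with y hy
    exact if_neg (not_le.2 hy)

/-- Gluing two antitone functions along a point where they agree gives an antitone function. -/
theorem antitoneOn_ite_le {f g : ℝ → ℝ} {s : Set ℝ} {c : ℝ} (hc : c ∈ s) (hfg : f c = g c)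
    (hf : AntitoneOn f (s ∩ Iic c)) (hg : AntitoneOn g (s ∩ Ici c)) :
    AntitoneOn (fun y => if y ≤ c then f y else g y) s := by
  intro x hx y hy hxy
  dsimp only
  split_ifs with h₁ h₂ h₂
  · exact hf ⟨hx, h₂⟩ ⟨hy, h₁⟩ hxy
  · exact absurd (hxy.trans h₁) h₂
  · exact (hg ⟨hc, self_mem_Ici⟩ ⟨hy, (not_le.1 h₁).le⟩ (not_le.1 h₁).le).trans
      (hfg ▸ hf ⟨hx, h₂⟩ ⟨hc, self_mem_Iic⟩ h₂)
  · exact hg ⟨hx, (not_le.1 h₂).le⟩ ⟨hy, (not_le.1 h₁).le⟩ hxy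

/-- The base-2 binary entropy is a rescaling of the natural one. -/
theorem binEnt_eq (x : ℝ) : binEnt x = binEntropy x / log 2 := by
  simp only [binEnt, binEntropy, logb, log_inv]
  ring

/-- The simplified form of the right branch of `h*`, in natural units, where `u` stands for
`log (1 - a) / 3 = log a / 4`. -/
noncomputable def rightBranch (u z : ℝ) : ℝ :=
  (negMulLog (2 - z) + negMulLog z) / 2 + (log 2 - 3 * u) - (log 2 - u) * z

/-- The derivative of `rightBranch`. -/
noncomputable def rightBranchDeriv (u z : ℝ) : ℝ :=
  (log (2 - z) - log z) / 2 - log 2 + u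

theorem continuous_rightBranch (u : ℝ) : Continuous (rightBranch u) := by
  unfold rightBranch
  have := continuous_negMulLog
  fun_prop

theorem hasDerivAt_rightBranch (u : ℝ) {z : ℝ} (hz : z ∈ Ioo (0 : ℝ) 1) :
    HasDerivAt (rightBranch u) (rightBranchDeriv u z) z := by
  have h₁ := hasDerivAt_negMulLog hz.1.ne'
  have h₂ := (hasDerivAt_negMulLog (x := 2 - z) (by linarith [hz.2])).comp z
    ((hasDerivAt_id z).const_sub 2)
  have h₃ := (((h₂.add h₁).div_const 2).add_const (log 2 - 3 * u)).sub
    ((hasDerivAt_id z).const_mul (log 2 - u))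
  refine h₃.congr_deriv ?_
  simp only [rightBranchDeriv]
  ring

theorem antitoneOn_rightBranchDeriv (u : ℝ) :
    AntitoneOn (rightBranchDeriv u) (Ioo (0 : ℝ) 1) := by
  intro x hx y hy hxy
  have h₁ := log_le_log hx.1 hxy
  have h₂ := log_le_log (by linarith [hy.2] : 0 < 2 - y) (by linarith : 2 - y ≤ 2 - x)
  simp only [rightBranchDeriv]
  linarith

/-- On `(0, 1]` the right branch of `h*` is `rightBranch`. -/
theorem Bbranch_eq {a u z : ℝ} (ha : a ∈ Ioo (0 : ℝ) 1) (hu : log a = 4 * u)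
    (hu' : log (1 - a) = 3 * u) (hz : z ∈ Ioc (0 : ℝ) 1) :
    Bbranch a (2 * binEnt a / (3 + a)) z = rightBranch u z / log 2 := by
  obtain ⟨ha0, ha1⟩ := ha
  obtain ⟨hz0, hz1⟩ := hz
  have h1a : 0 < 1 - a := by linarith
  have h2z : 0 < 2 - z := by linarith
  have hl2 : log 2 ≠ 0 := (log_pos one_lt_two).ne'
  have hρ : 2 * binEnt a / (3 + a) = -2 * u / log 2 := by
    rw [binEnt_eq]
    simp only [binEntropy, log_inv, hu, hu']
    have : (3 + a) ≠ 0 := by positivity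
    field_simp
    ring
  obtain ⟨s, hs⟩ : ∃ s, s = 2 * a + (1 - a) * z := ⟨_, rfl⟩
  have hs0 : 0 < s := by rw [hs]; positivity
  have e₁ : log (s / 2) = log s - log 2 := log_div hs0.ne' two_ne_zero
  have e₂ : log (1 - s / 2) = 3 * u + log (2 - z) - log 2 := by
    rw [show 1 - s / 2 = (1 - a) * (2 - z) / 2 by rw [hs]; ring,
      log_div (by positivity) two_ne_zero, log_mul h1a.ne' h2z.ne', hu']
  have e₃ : log (2 * a / s) = log 2 + 4 * u - log s := by
    rw [log_div (by positivity) hs0.ne', log_mul two_ne_zero ha0.ne', hu]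
  have e₄ : log (1 - 2 * a / s) = 3 * u + log z - log s := by
    rw [show 1 - 2 * a / s = (1 - a) * z / s by field_simp; rw [hs]; ring,
      log_div (by positivity) hs0.ne', log_mul h1a.ne' hz0.ne', hu']
  rw [Bbranch, hρ, binEnt_eq, binEnt_eq, show a * (2 - z) + z = s by rw [hs]; ring, ← hs]
  simp only [binEntropy, log_inv, e₁, e₂, e₃, e₄, rightBranch, negMulLog]
  field_simp
  rw [hs]
  ring

/-- The middle and right branches of `h*` agree at the point `2a/(1+a)`. -/
theorem rightBranch_eq_binEntropy {a u : ℝ} (ha : a ∈ Ioo (0 : ℝ) 1) (hu : log a = 4 * u)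
    (hu' : log (1 - a) = 3 * u) :
    binEntropy (2 * a / (1 + a)) = rightBranch u (2 * a / (1 + a)) := by
  obtain ⟨ha0, ha1⟩ := ha
  have h1a : 0 < 1 - a := by linarith
  have hp : 0 < 1 + a := by linarith
  have e₁ : log (2 * a / (1 + a)) = log 2 + 4 * u - log (1 + a) := by
    rw [log_div (by positivity) hp.ne', log_mul two_ne_zero ha0.ne', hu]
  have e₂ : log (1 - 2 * a / (1 + a)) = 3 * u - log (1 + a) := by
    rw [show 1 - 2 * a / (1 + a) = (1 - a) / (1 + a) by field_simp; ring,
      log_div h1a.ne' hp.ne', hu']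
  have e₃ : log (2 - 2 * a / (1 + a)) = log 2 - log (1 + a) := by
    rw [show 2 - 2 * a / (1 + a) = 2 / (1 + a) by field_simp; ring,
      log_div two_ne_zero hp.ne']
  simp only [binEntropy, rightBranch, negMulLog, log_inv, e₁, e₂, e₃]
  field_simp
  ring

/-- The slopes of the middle and right branches of `h*` agree at the point `2a/(1+a)`. -/
theorem rightBranchDeriv_eq {a u : ℝ} (ha : a ∈ Ioo (0 : ℝ) 1) (hu : log a = 4 * u)
    (hu' : log (1 - a) = 3 * u) :
    log (1 - 2 * a / (1 + a)) - log (2 * a / (1 + a)) =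
      rightBranchDeriv u (2 * a / (1 + a)) := by
  obtain ⟨ha0, ha1⟩ := ha
  have h1a : 0 < 1 - a := by linarith
  have hp : 0 < 1 + a := by linarith
  rw [rightBranchDeriv, show 1 - 2 * a / (1 + a) = (1 - a) / (1 + a) by field_simp; ring,
    show 2 - 2 * a / (1 + a) = 2 / (1 + a) by field_simp; ring,
    log_div h1a.ne' hp.ne', log_div (by positivity) hp.ne', log_div two_ne_zero hp.ne',
    log_mul two_ne_zero ha0.ne', hu, hu']
  ring

/-- `h*` in natural units, with simplified outer branches; `c` is the right gluing point. -/
noncomputable def natHStar (u c z : ℝ) : ℝ :=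
  if z ≤ 1 - c then rightBranch u (1 - z)
  else if z ≤ c then binEntropy z else rightBranch u z

/-- The derivative of `natHStar`. -/
noncomputable def natHStarDeriv (u c z : ℝ) : ℝ :=
  if z ≤ 1 - c then -rightBranchDeriv u (1 - z)
  else if z ≤ c then log (1 - z) - log z else rightBranchDeriv u z

section Gluing

variable {u c : ℝ}

theorem continuous_natHStar (hc : 1 - c < c) (hval : binEntropy c = rightBranch u c) :
    Continuous (natHStar u c) := by
  have hB := continuous_rightBranch u
  refine Continuous.if_le (by fun_prop)
    (Continuous.if_le binEntropy_continuous hB continuous_id continuous_const ?_)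
    continuous_id continuous_const ?_
  · rintro x rfl
    exact hval
  · rintro x rfl
    simp [hc.le, hval]

theorem hasDerivAt_natHStar (hc : 1 - c < c) (hval : binEntropy c = rightBranch u c)
    (hder : log (1 - c) - log c = rightBranchDeriv u c) {z : ℝ} (hz : z ∈ Ioo (0 : ℝ) 1) :
    HasDerivAt (natHStar u c) (natHStarDeriv u c z) z := by
  have hz' : 1 - z ∈ Ioo (0 : ℝ) 1 := ⟨by linarith [hz.2], by linarith [hz.1]⟩
  refine hasDerivAt_ite_le (by simp [hc.le, hval]) (fun h => ?_) (fun h => ?_)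
  · have := (hasDerivAt_rightBranch u hz').comp z ((hasDerivAt_id z).const_sub 1)
    refine this.congr_deriv ?_
    simp [natHStarDeriv, h]
  · refine hasDerivAt_ite_le hval (fun h' => ?_) (fun h' => ?_)
    · refine (hasDerivAt_binEntropy hz.1.ne' hz.2.ne).congr_deriv ?_
      rcases eq_or_lt_of_le h with rfl | h
      · simp [natHStarDeriv, ← hder]
      · simp [natHStarDeriv, h.not_ge, h']
    · refine (hasDerivAt_rightBranch u hz).congr_deriv ?_
      have h₀ : ¬ z ≤ 1 - c := by linarith
      rcases eq_or_lt_of_le h' with rfl | h'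
      · simp [natHStarDeriv, hc, hder]
      · simp [natHStarDeriv, h₀, h'.not_ge]

theorem antitoneOn_natHStarDeriv (hc : 1 - c < c) (hc1 : c < 1)
    (hder : log (1 - c) - log c = rightBranchDeriv u c) :
    AntitoneOn (natHStarDeriv u c) (Ioo (0 : ℝ) 1) := by
  refine antitoneOn_ite_le ⟨by linarith, by linarith⟩ (by simp [hc.le, ← hder]) ?_ ?_
  · rintro x ⟨hx, -⟩ y ⟨hy, -⟩ hxy
    exact neg_le_neg (antitoneOn_rightBranchDeriv u
      ⟨by linarith [hy.2], by linarith [hy.1]⟩ ⟨by linarith [hx.2], by linarith [hx.1]⟩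
      (by linarith))
  · refine AntitoneOn.mono ?_ inter_subset_left
    refine antitoneOn_ite_le ⟨by linarith, hc1⟩ hder ?_
      ((antitoneOn_rightBranchDeriv u).mono inter_subset_left)
    rintro x ⟨hx, -⟩ y ⟨hy, -⟩ hxy
    have h₁ := log_le_log hx.1 hxy
    have h₂ := log_le_log (by linarith [hy.2] : 0 < 1 - y) (by linarith : 1 - y ≤ 1 - x)
    dsimp only
    linarith

theorem concaveOn_natHStar (hc : 1 - c < c) (hc1 : c < 1)
    (hval : binEntropy c = rightBranch u c)
    (hder : log (1 - c) - log c = rightBranchDeriv u c) :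
    ConcaveOn ℝ (Icc (0 : ℝ) 1) (natHStar u c) := by
  have hD : ∀ z ∈ Ioo (0 : ℝ) 1, HasDerivAt (natHStar u c) (natHStarDeriv u c z) z :=
    fun z hz => hasDerivAt_natHStar hc hval hder hz
  refine AntitoneOn.concaveOn_of_deriv (convex_Icc 0 1)
    (continuous_natHStar hc hval).continuousOn ?_ ?_ <;> rw [interior_Icc]
  · exact fun z hz => (hD z hz).differentiableAt.differentiableWithinAt
  · exact (antitoneOn_natHStarDeriv hc hc1 hder).congr fun z hz => (hD z hz).deriv.symm

end Gluing

/-- `h*` is a rescaling of `natHStar` on the unit interval. -/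
theorem hStar_eq {a u : ℝ} (ha : a ∈ Ioo (0 : ℝ) 1) (ha3 : 1 < 3 * a) (hu : log a = 4 * u)
    (hu' : log (1 - a) = 3 * u) {z : ℝ} (hz : z ∈ Icc (0 : ℝ) 1) :
    hStar a (2 * binEnt a / (3 + a)) z = (log 2)⁻¹ * natHStar u (2 * a / (1 + a)) z := by
  have hp : 0 < 1 + a := by linarith [ha.1]
  have hc : (1 - a) / (1 + a) = 1 - 2 * a / (1 + a) := by field_simp; ring
  have hc0 : 0 < 2 * a / (1 + a) := div_pos (by linarith [ha.1]) hp
  have hlt : (1 - a) / (1 + a) < 2 * a / (1 + a) := by gcongr; linarith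
  rw [inv_mul_eq_div, hStar, natHStar, ← hc]
  rcases lt_trichotomy z ((1 - a) / (1 + a)) with h | h | h
  · rw [if_pos h, if_pos h.le, Bbranch_eq ha hu hu' ⟨by linarith, by linarith [hz.1]⟩]
  · rw [if_neg h.not_lt, if_pos h.le, if_pos (h.trans_lt hlt).le, binEnt_eq,
      show 1 - z = 2 * a / (1 + a) by rw [h, hc]; ring, ← rightBranch_eq_binEntropy ha hu hu',
      ← binEntropy_one_sub z, h, hc, sub_sub_cancel]
  · rw [if_neg h.not_gt, if_neg h.not_ge]
    split_ifs with h'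
    · exact binEnt_eq z
    · exact Bbranch_eq ha hu hu' ⟨by linarith, hz.2⟩

theorem hStar_continuous_concave (a : ℝ) (ha : a ∈ Set.Ioo (0 : ℝ) 1)
    (haroot : a ^ 4 - 5 * a ^ 3 + 6 * a ^ 2 - 4 * a + 1 = 0)
    (hauniq : ∀ x ∈ Set.Ioo (0 : ℝ) 1,
      x ^ 4 - 5 * x ^ 3 + 6 * x ^ 2 - 4 * x + 1 = 0 → x = a) :
    ContinuousOn (hStar a (2 * binEnt a / (3 + a))) (Set.Icc (0 : ℝ) 1) ∧
      ConcaveOn ℝ (Set.Icc (0 : ℝ) 1) (hStar a (2 * binEnt a / (3 + a))) := by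
  obtain ⟨ha0, ha1⟩ := id ha
  have h1a : 0 < 1 - a := by linarith
  have hp : 0 < 1 + a := by linarith
  have ha3 : 1 < 3 * a := by
    by_contra! h
    nlinarith [mul_nonneg ha0.le (sub_nonneg.2 h), mul_nonneg (sq_nonneg a) (sub_nonneg.2 h),
      sq_nonneg (a ^ 2)]
  obtain ⟨u, hu'⟩ : ∃ u, log (1 - a) = 3 * u := ⟨log (1 - a) / 3, by ring⟩
  have hu : log a = 4 * u := by
    have hpow : a ^ 3 = (1 - a) ^ 4 := by linear_combination -haroot
    have := congrArg log hpow
    rw [log_pow, log_pow, hu'] at this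
    push_cast at this
    linarith
  have hc1 : 2 * a / (1 + a) < 1 := by rw [div_lt_one hp]; linarith
  have hc : 1 - 2 * a / (1 + a) < 2 * a / (1 + a) := by
    rw [show 1 - 2 * a / (1 + a) = (1 - a) / (1 + a) by field_simp; ring]
    gcongr
    linarith
  have hval := rightBranch_eq_binEntropy ha hu hu'
  have hder := rightBranchDeriv_eq ha hu hu'
  have heq : EqOn (hStar a (2 * binEnt a / (3 + a)))
      (fun z => (log 2)⁻¹ * natHStar u (2 * a / (1 + a)) z) (Icc 0 1) :=
    fun z hz => hStar_eq ha ha3 hu hu' hz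
  refine ⟨((continuous_natHStar hc hval).const_mul _).continuousOn.congr heq, ?_⟩
  exact ((concaveOn_natHStar hc hc1 hval hder).smul
    (inv_nonneg.2 (log_nonneg one_le_two))).congr heq.symm
end

section
/- Let B(z) = (1/(1-a))·H_b((2a+(1-a)z)/2) - z + ((az-4a-z)/(2(1-a)))·ρ + ((2a+(1-a)z)/(2(1-a)))·H_b(2a/(a(2-z)+z)) and let z₂ = 2a/(1+a). Then B(z₂) = H_b(z₂) and B'(z₂) = H_b'(z₂) = log₂((1-z₂)/z₂); i.e., the two branches of h* fit continuously and with matching derivative at z₂. -/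
theorem hasDerivAt_binEnt_s12 {x : ℝ} (hx0 : 0 < x) (hx1 : x < 1) :
    HasDerivAt binEnt (Real.logb 2 ((1 - x) / x)) x := by
  have h1x : 1 - x ≠ 0 := by linarith
  have hlog {y : ℝ} (hy : y ≠ 0) : HasDerivAt (Real.logb 2) (y⁻¹ / Real.log 2) y := by
    exact (Real.hasDerivAt_log hy).div_const (Real.log 2)
  have hid : HasDerivAt (fun y : ℝ => y) 1 x := hasDerivAt_id x
  have hsub : HasDerivAt (fun y : ℝ => 1 - y) (-1) x := hid.const_sub 1
  have h := ((hid.mul (hlog hx0.ne')).neg).sub (hsub.mul ((hlog h1x).comp x hsub))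
  refine h.congr_deriv ?_
  rw [Real.logb_div h1x hx0.ne']
  simp only [Function.comp_apply]
  have : Real.log 2 ≠ 0 := (Real.log_pos one_lt_two).ne'
  field_simp
  ring

theorem hasDerivAt_Bbranch {a ρ z : ℝ} (ha : a ∈ Set.Ioo (0 : ℝ) 1) (hz0 : 0 < z) (hz1 : z < 2) :
    HasDerivAt (Bbranch a ρ)
      (1 / 2 * Real.logb 2
          ((1 - (2 * a + (1 - a) * z) / 2) / ((2 * a + (1 - a) * z) / 2))
        - 1 - ρ / 2 + 1 / 2 * binEnt (2 * a / (a * (2 - z) + z))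
        - a / (a * (2 - z) + z) * Real.logb 2
          ((1 - 2 * a / (a * (2 - z) + z)) / (2 * a / (a * (2 - z) + z)))) z := by
  obtain ⟨ha0, ha1⟩ := ha
  have h1a : 0 < 1 - a := by linarith
  have hD : 2 * a + (1 - a) * z = a * (2 - z) + z := by ring
  have hzpos : 0 < (1 - a) * z := mul_pos h1a hz0
  have hDpos : 0 < a * (2 - z) + z := by rw [← hD]; positivity
  have hid : HasDerivAt (fun y : ℝ => y) 1 z := hasDerivAt_id z
  have hnum : HasDerivAt (fun y : ℝ => 2 * a + (1 - a) * y) (1 - a) z := by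
    simpa using (hid.const_mul (1 - a)).const_add (2 * a)
  have hden : HasDerivAt (fun y : ℝ => a * (2 - y) + y) (1 - a) z :=
    (((hid.const_sub 2).const_mul a).add hid).congr_deriv (by ring)
  have hlin : HasDerivAt (fun y : ℝ => a * y - 4 * a - y) (a - 1) z :=
    (((hid.const_mul a).sub_const (4 * a)).sub hid).congr_deriv (by ring)
  have hent₁ := (hasDerivAt_binEnt_s12 (x := (2 * a + (1 - a) * z) / 2) (by positivity)
    (by nlinarith)).comp z (hnum.div_const 2)
  have hent₂ := (hasDerivAt_binEnt_s12 (x := 2 * a / (a * (2 - z) + z)) (by positivity)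
    (by rw [div_lt_one hDpos]; linarith)).comp z
      ((hasDerivAt_const z (2 * a)).div hden hDpos.ne')
  have h := (((hent₁.const_mul (1 / (1 - a))).sub hid).add
    ((hlin.div_const (2 * (1 - a))).mul_const ρ)).add
    ((hnum.div_const (2 * (1 - a))).mul hent₂)
  refine h.congr_deriv ?_
  simp only [Function.comp_apply, Pi.div_apply, hD]
  generalize Real.logb 2 _ = u
  generalize Real.logb 2 _ = v
  generalize binEnt _ = w
  field_simp
  ring

theorem logb_root {a : ℝ} (haroot : a ^ 4 - 5 * a ^ 3 + 6 * a ^ 2 - 4 * a + 1 = 0) :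
    3 * Real.logb 2 a = 4 * Real.logb 2 (1 - a) := by
  have h : a ^ 3 = (1 - a) ^ 4 := by linarith
  simpa [Real.logb_pow] using congrArg (Real.logb 2) h

theorem branches_fit_at_z2 (a : ℝ) (ha : a ∈ Set.Ioo (0 : ℝ) 1)
    (haroot : a ^ 4 - 5 * a ^ 3 + 6 * a ^ 2 - 4 * a + 1 = 0)
    (hauniq : ∀ x ∈ Set.Ioo (0 : ℝ) 1,
      x ^ 4 - 5 * x ^ 3 + 6 * x ^ 2 - 4 * x + 1 = 0 → x = a) :
    Bbranch a (2 * binEnt a / (3 + a)) (2 * a / (1 + a)) = binEnt (2 * a / (1 + a)) ∧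
      HasDerivAt (Bbranch a (2 * binEnt a / (3 + a)))
        (Real.logb 2 ((1 - 2 * a / (1 + a)) / (2 * a / (1 + a)))) (2 * a / (1 + a)) ∧
      HasDerivAt binEnt
        (Real.logb 2 ((1 - 2 * a / (1 + a)) / (2 * a / (1 + a)))) (2 * a / (1 + a)) := by
  obtain ⟨ha0, ha1⟩ := ha
  have h1a : 0 < 1 - a := by linarith
  have hs : 0 < 1 + a := by linarith
  have hz0 : 0 < 2 * a / (1 + a) := by positivity
  have hz1 : 2 * a / (1 + a) < 1 := by rw [div_lt_one hs]; linarith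
  have hroot := logb_root haroot
  have hx : (2 * a + (1 - a) * (2 * a / (1 + a))) / 2 = 2 * a / (1 + a) := by
    field_simp; ring
  have hD : a * (2 - 2 * a / (1 + a)) + 2 * a / (1 + a) = 4 * a / (1 + a) := by
    field_simp; ring
  have hq : 2 * a / (4 * a / (1 + a)) = (1 + a) / 2 := by
    field_simp; ring
  have h1z : 1 - 2 * a / (1 + a) = (1 - a) / (1 + a) := by
    field_simp; ring
  have h1q : 1 - (1 + a) / 2 = (1 - a) / 2 := by ring
  have h22 : Real.logb 2 2 = 1 := Real.logb_self_eq_one one_lt_two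
  have hlz : Real.logb 2 (2 * a / (1 + a)) = 1 + Real.logb 2 a - Real.logb 2 (1 + a) := by
    rw [Real.logb_div (by positivity) hs.ne', Real.logb_mul two_ne_zero ha0.ne', h22]
  have hl1z : Real.logb 2 ((1 - a) / (1 + a)) = Real.logb 2 (1 - a) - Real.logb 2 (1 + a) :=
    Real.logb_div h1a.ne' hs.ne'
  have hlq : Real.logb 2 ((1 + a) / 2) = Real.logb 2 (1 + a) - 1 := by
    rw [Real.logb_div hs.ne' two_ne_zero, h22]
  have hl1q : Real.logb 2 ((1 - a) / 2) = Real.logb 2 (1 - a) - 1 := by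
    rw [Real.logb_div h1a.ne' two_ne_zero, h22]
  refine ⟨?_, ?_, hasDerivAt_binEnt_s12 hz0 hz1⟩
  · have hx' : (2 * a + (1 - a) * (2 * a / (1 + a))) / (2 * (1 - a))
        = 2 * a / (1 + a) / (1 - a) := by
      rw [← div_div, hx]
    simp only [Bbranch, hx, hx', hD, hq]
    simp only [binEnt, h1z, h1q, hlz, hl1z, hlq, hl1q]
    field_simp
    ring
  · refine (hasDerivAt_Bbranch ⟨ha0, ha1⟩ hz0 (by linarith)).congr_deriv ?_
    simp only [hx, hD, hq, h1z, h1q]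
    rw [Real.logb_div (div_pos h1a hs).ne' hz0.ne',
      Real.logb_div (half_pos h1a).ne' (half_pos hs).ne']
    simp only [binEnt, h1q, hlz, hl1z, hlq, hl1q]
    have ha4 : Real.logb 2 a = 4 / 3 * Real.logb 2 (1 - a) := by linarith
    rw [ha4]
    field_simp
    ring
end

section
/- For every z ∈ [(1-a)/(1+a), 2a/(1+a)], the identity g_z(z, 1-z) = H_b(z) + ρ holds; i.e., the Bellman-operator expression evaluated at the policy δ = z, γ = 1-z equals h*(z) + ρ on the middle interval. -/
/-- For `ρ = 2 H_b(a) / (3 + a)`, the right-interval branch takes the value `ρ` at the endpoint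
`z = 1`. -/
theorem Bbranch_one {a : ℝ} (ha : a ∈ Set.Ioo (0 : ℝ) 1) :
    Bbranch a (2 * binEnt a / (3 + a)) 1 = 2 * binEnt a / (3 + a) := by
  obtain ⟨h0, h1⟩ := ha
  have hs : 1 - a ≠ 0 := by linarith
  have hp : 1 + a ≠ 0 := by linarith
  have h3 : 3 + a ≠ 0 := by linarith
  have hl2 : Real.logb 2 2 = 1 := Real.logb_self_eq_one (by norm_num)
  have hmid : 2 * binEnt ((1 + a) / 2)
      = 2 - (1 + a) * Real.logb 2 (1 + a) - (1 - a) * Real.logb 2 (1 - a) := by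
    rw [binEnt, show 1 - (1 + a) / 2 = (1 - a) / 2 by ring,
      Real.logb_div hp two_ne_zero, Real.logb_div hs two_ne_zero, hl2]
    ring
  have hratio : (1 + a) * binEnt (2 * a / (1 + a))
      = (1 + a) * Real.logb 2 (1 + a) - 2 * a * (1 + Real.logb 2 a)
        - (1 - a) * Real.logb 2 (1 - a) := by
    rw [binEnt, show 1 - 2 * a / (1 + a) = (1 - a) / (1 + a) by field_simp; ring,
      Real.logb_div (by positivity) hp, Real.logb_div hs hp,
      Real.logb_mul two_ne_zero h0.ne', hl2]
    field_simp
    ring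
  have hsum : 2 * binEnt ((1 + a) / 2) + (1 + a) * binEnt (2 * a / (1 + a))
      = 2 * (1 - a) + 2 * binEnt a := by
    rw [hmid, hratio, binEnt]
    ring
  rw [Bbranch, show (2 * a + (1 - a) * 1) / 2 = (1 + a) / 2 by ring,
    show a * (2 - 1) + 1 = 1 + a by ring]
  generalize binEnt ((1 + a) / 2) = x at hsum ⊢
  generalize binEnt (2 * a / (1 + a)) = y at hsum ⊢
  field_simp
  linear_combination (3 + a) * hsum

theorem hStar_one {a : ℝ} (ha : a ∈ Set.Ioo (0 : ℝ) 1) (ρ : ℝ) :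
    hStar a ρ 1 = Bbranch a ρ 1 := by
  obtain ⟨h0, h1⟩ := ha
  rw [hStar, if_neg, if_neg]
  · rw [le_div_iff₀ (by linarith)]
    linarith
  · rw [lt_div_iff₀ (by linarith)]
    linarith

theorem hStar_zero {a : ℝ} (ha : a ∈ Set.Ioo (0 : ℝ) 1) (ρ : ℝ) :
    hStar a ρ 0 = Bbranch a ρ 1 := by
  obtain ⟨h0, h1⟩ := ha
  rw [hStar, if_pos (div_pos (by linarith) (by linarith)), sub_zero]

theorem bellman_middle_interval (a : ℝ) (ha : a ∈ Set.Ioo (0 : ℝ) 1)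
    (haroot : a ^ 4 - 5 * a ^ 3 + 6 * a ^ 2 - 4 * a + 1 = 0)
    (hauniq : ∀ x ∈ Set.Ioo (0 : ℝ) 1,
      x ^ 4 - 5 * x ^ 3 + 6 * x ^ 2 - 4 * x + 1 = 0 → x = a) :
    ∀ z ∈ Set.Icc ((1 - a) / (1 + a)) (2 * a / (1 + a)),
      gObj a (2 * binEnt a / (3 + a)) z z (1 - z)
        = binEnt z + 2 * binEnt a / (3 + a) := by
  intro z _
  rw [gObj, sub_self z, zero_div, add_zero, sub_self (1 - z), zero_div, hStar_one ha,
    hStar_zero ha, Bbranch_one ha, show 1 / 2 + (z - (1 - z)) / 2 = z by ring]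
  ring
end

section
/- Define δ*(z) = z for z ∈ [0, 2a/(1+a)] and δ*(z) = a(2-z) for z ∈ [2a/(1+a), 1], and γ*(z) = a + az for z ∈ [0, (1-a)/(1+a)] and γ*(z) = 1-z for z ∈ [(1-a)/(1+a), 1]. Then for every z ∈ [0,1] and every (δ,γ) with 0 ≤ δ ≤ z and 0 ≤ γ ≤ 1-z, g_z(δ,γ) ≤ g_z(δ*(z), γ*(z)); i.e., the policy (δ*, γ*) maximizes the Bellman-operator expression. -/
/-- The optimal action `δ*(z)`: `δ*(z) = z` on `[0, 2a/(1+a)]` and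
`δ*(z) = a(2-z)` on `[2a/(1+a), 1]`. -/
noncomputable def deltaStar (a z : ℝ) : ℝ :=
  if z ≤ 2 * a / (1 + a) then z else a * (2 - z)

/-- The optimal action `γ*(z)`: `γ*(z) = a + az` on `[0, (1-a)/(1+a)]` and
`γ*(z) = 1-z` on `[(1-a)/(1+a), 1]`. -/
noncomputable def gammaStar (a z : ℝ) : ℝ :=
  if z ≤ (1 - a) / (1 + a) then a + a * z else 1 - z

lemma mul_log_sub_le {x q : ℝ} (hx : 0 ≤ x) (hq : 0 < q) :
    x * (Real.log q - Real.log x) ≤ q - x := by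
  rcases hx.eq_or_lt with rfl | hx
  · simpa using hq.le
  · have h := Real.log_le_sub_one_of_pos (div_pos hq hx)
    rw [Real.log_div hq.ne' hx.ne'] at h
    calc x * (Real.log q - Real.log x) ≤ x * (q / x - 1) := by gcongr
      _ = q - x := by field_simp

/-- Gibbs' inequality for binary distributions. -/
lemma binEnt_le_cross {x q : ℝ} (hx0 : 0 ≤ x) (hx1 : x ≤ 1) (hq0 : 0 < q) (hq1 : q < 1) :
    binEnt x ≤ -(x * Real.logb 2 q) - (1 - x) * Real.logb 2 (1 - q) := by
  have h1 := mul_log_sub_le hx0 hq0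
  have h2 := mul_log_sub_le (sub_nonneg.2 hx1) (sub_pos.2 hq1)
  have h2pos : 0 < Real.log 2 := Real.log_pos (by norm_num)
  have key : (x * (Real.log q - Real.log x)
      + (1 - x) * (Real.log (1 - q) - Real.log (1 - x))) / Real.log 2 ≤ 0 :=
    div_nonpos_of_nonpos_of_nonneg (by linarith) h2pos.le
  unfold binEnt Real.logb
  have e : (x * (Real.log q - Real.log x)
      + (1 - x) * (Real.log (1 - q) - Real.log (1 - x))) / Real.log 2
      = x * (Real.log q / Real.log 2) - x * (Real.log x / Real.log 2)
        + ((1 - x) * (Real.log (1 - q) / Real.log 2)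
        - (1 - x) * (Real.log (1 - x) / Real.log 2)) := by ring
  linarith

/-- The grouping property of entropy collapses the right branch to a single entropy term. -/
lemma Bbranch_eq_s17 {a r z : ℝ} (ha0 : 0 < a) (ha1 : a < 1)
    (hr : binEnt a = r * (3 + a) / 2) (hz0 : 0 < z) (hz2 : z < 2) :
    Bbranch a r z = binEnt (z / 2) - z + (3 - z) * r / 2 := by
  have h1a : 0 < 1 - a := by linarith
  have h2z : 0 < 2 - z := by linarith
  have hm : 0 < 2 * a + (1 - a) * z := by positivity
  have e1 : 1 - (2 * a + (1 - a) * z) / 2 = (1 - a) * (2 - z) / 2 := by ring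
  have e2 : a * (2 - z) + z = 2 * a + (1 - a) * z := by ring
  have e3 : 1 - 2 * a / (2 * a + (1 - a) * z) = (1 - a) * z / (2 * a + (1 - a) * z) := by
    field_simp; ring
  have e4 : 1 - z / 2 = (2 - z) / 2 := by ring
  unfold Bbranch
  rw [e2]
  unfold binEnt at hr ⊢
  rw [e1, e3, e4]
  have l2 : Real.logb 2 2 = 1 := Real.logb_self_eq_one (by norm_num)
  rw [Real.logb_div hm.ne' two_ne_zero, Real.logb_div (by positivity) two_ne_zero,
    Real.logb_div (by positivity) hm.ne', Real.logb_div (by positivity) hm.ne',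
    Real.logb_mul h1a.ne' h2z.ne', Real.logb_mul two_ne_zero ha0.ne',
    Real.logb_mul h1a.ne' hz0.ne', Real.logb_div hz0.ne' two_ne_zero,
    Real.logb_div h2z.ne' two_ne_zero, l2]
  have hrr : r * (3 + a) = 2 * (-(a * Real.logb 2 a) - (1 - a) * Real.logb 2 (1 - a)) := by
    linarith
  generalize Real.logb 2 (2 * a + (1 - a) * z) = M
  generalize Real.logb 2 a = A at *
  generalize Real.logb 2 (1 - a) = A' at *
  generalize Real.logb 2 z = Z
  generalize Real.logb 2 (2 - z) = Z'
  have h1a' := h1a.ne'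
  field_simp
  linear_combination (-1) * hrr

/-- The cross-entropy form of the tangent line at `y` to `x ↦ H_b(x/2) - x + (3 - x) r / 2`. -/
noncomputable def branchTangent (r y x : ℝ) : ℝ :=
  -(x / 2 * Real.logb 2 (y / 2)) - (1 - x / 2) * Real.logb 2 (1 - y / 2) - x + (3 - x) * r / 2

lemma branchTangent_self (r y : ℝ) :
    branchTangent r y y = binEnt (y / 2) - y + (3 - y) * r / 2 := rfl

lemma le_branchTangent (r : ℝ) {x y : ℝ} (hx0 : 0 ≤ x) (hx2 : x ≤ 2) (hy0 : 0 < y)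
    (hy2 : y < 2) : binEnt (x / 2) - x + (3 - x) * r / 2 ≤ branchTangent r y x := by
  have := binEnt_le_cross (x := x / 2) (q := y / 2) (by linarith) (by linarith) (by linarith)
    (by linarith)
  unfold branchTangent
  linarith

/-- Tangent lines to a concave function: moving the point of tangency to the right
raises the line on the left. -/
lemma branchTangent_le_branchTangent (r : ℝ) {x y y' : ℝ} (hy0 : 0 < y) (hyy' : y ≤ y')
    (hy2 : y' < 2) (hxy : x ≤ y) : branchTangent r y x ≤ branchTangent r y' x := by
  have h := le_branchTangent r (x := y) (y := y') hy0.le (by linarith) (by linarith) hy2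
  rw [← branchTangent_self] at h
  have l1 : Real.logb 2 (y / 2) ≤ Real.logb 2 (y' / 2) :=
    Real.logb_le_logb_of_le (by norm_num) (by linarith) (by linarith)
  have l2 : Real.logb 2 (1 - y' / 2) ≤ Real.logb 2 (1 - y / 2) :=
    Real.logb_le_logb_of_le (by norm_num) (by linarith) (by linarith)
  unfold branchTangent at *
  nlinarith [mul_nonneg (sub_nonneg.2 hxy) (add_nonneg (sub_nonneg.2 l1) (sub_nonneg.2 l2))]

lemma binEnt_one_sub (x : ℝ) : binEnt (1 - x) = binEnt x := by
  unfold binEnt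
  rw [sub_sub_cancel]
  ring

lemma one_sub_breakpoint {a : ℝ} (ha0 : 0 < a) : 1 - 2 * a / (1 + a) = (1 - a) / (1 + a) := by
  field_simp; ring

/-- The relations between `a` and `r = ρ` that encode the optimality of the breakpoint. -/
structure IsOptimalParam (a r : ℝ) : Prop where
  third_lt : 1 / 3 < a
  lt_one : a < 1
  logb_self : Real.logb 2 a = -(2 * r)
  logb_one_sub : Real.logb 2 (1 - a) = -(3 / 2 * r)

namespace IsOptimalParam

variable {a r : ℝ}

lemma of_root (ha : a ∈ Set.Ioo (0 : ℝ) 1)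
    (hroot : a ^ 4 - 5 * a ^ 3 + 6 * a ^ 2 - 4 * a + 1 = 0) :
    IsOptimalParam a (2 * binEnt a / (3 + a)) := by
  obtain ⟨ha0, ha1⟩ := ha
  have hpow : a ^ 3 = (1 - a) ^ 4 := by linear_combination -hroot
  have hthird : 1 / 3 < a := by
    by_contra! h
    have h1 : a ^ 3 ≤ (1 / 3) ^ 3 := by gcongr
    have h2 : (2 / 3 : ℝ) ^ 4 ≤ (1 - a) ^ 4 := by gcongr; linarith
    norm_num at h1 h2
    linarith
  have hlog : 3 * Real.logb 2 a = 4 * Real.logb 2 (1 - a) := by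
    have := congrArg (Real.logb 2) hpow
    rw [Real.logb_pow, Real.logb_pow] at this
    exact_mod_cast this
  have h3 : 3 + a ≠ 0 := by linarith
  refine ⟨hthird, ha1, ?_, ?_⟩ <;> unfold binEnt <;> field_simp
  · linear_combination (1 - a) * hlog
  · linear_combination -a * hlog

lemma pos (h : IsOptimalParam a r) : 0 < a := by linarith [h.third_lt]

lemma binEnt_eq (h : IsOptimalParam a r) : binEnt a = r * (3 + a) / 2 := by
  unfold binEnt
  rw [h.logb_self, h.logb_one_sub]
  ring

lemma breakpoints_le (h : IsOptimalParam a r) : (1 - a) / (1 + a) ≤ 2 * a / (1 + a) := by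
  have := h.pos
  have := h.third_lt
  gcongr
  linarith

lemma breakpoint_pos (h : IsOptimalParam a r) : 0 < 2 * a / (1 + a) := by
  have := h.pos
  positivity

lemma breakpoint_lt_one (h : IsOptimalParam a r) : 2 * a / (1 + a) < 1 := by
  have := h.pos
  rw [div_lt_one (by linarith)]
  linarith [h.lt_one]

lemma half_lt_breakpoint (h : IsOptimalParam a r) : 1 / 2 < 2 * a / (1 + a) := by
  have := h.pos
  rw [lt_div_iff₀ (by linarith)]
  linarith [h.third_lt]

lemma logb_two_mul (h : IsOptimalParam a r) : Real.logb 2 (2 * a) = 1 - 2 * r := by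
  rw [Real.logb_mul two_ne_zero h.pos.ne', Real.logb_self_eq_one (by norm_num), h.logb_self]
  ring

lemma logb_one_sub_le (h : IsOptimalParam a r) : -(3 / 2 * r) ≤ 1 - 2 * r := by
  rw [← h.logb_two_mul, ← h.logb_one_sub]
  exact Real.logb_le_logb_of_le (by norm_num) (by linarith [h.lt_one]) (by linarith [h.third_lt])

lemma hStar_one_sub (h : IsOptimalParam a r) (x : ℝ) :
    hStar a r (1 - x) = hStar a r x := by
  have hb := one_sub_breakpoint h.pos
  have hcb := h.breakpoints_le
  unfold hStar
  split_ifs <;> first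
    | rfl
    | (exfalso; linarith)
    | rw [sub_sub_cancel]
    | exact binEnt_one_sub x

lemma branchTangent_breakpoint (h : IsOptimalParam a r) (x : ℝ) :
    branchTangent r (2 * a / (1 + a)) x
      = Real.logb 2 (1 + a) - x + 3 * r / 2 + x * r / 2 := by
  have ha := h.pos
  have e1 : 2 * a / (1 + a) / 2 = a / (1 + a) := by field_simp
  have e2 : 1 - a / (1 + a) = 1 / (1 + a) := by field_simp; ring
  unfold branchTangent
  rw [e1, e2, Real.logb_div ha.ne' (by positivity), Real.logb_div one_ne_zero (by positivity),
    h.logb_self, Real.logb_one]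
  ring

lemma cross_breakpoint (h : IsOptimalParam a r) (x : ℝ) :
    -(x * Real.logb 2 (2 * a / (1 + a))) - (1 - x) * Real.logb 2 (1 - 2 * a / (1 + a))
      = branchTangent r (2 * a / (1 + a)) x := by
  have ha := h.pos
  have ha1 := h.lt_one
  rw [h.branchTangent_breakpoint, one_sub_breakpoint ha,
    Real.logb_div (by positivity) (by positivity), Real.logb_div (by linarith) (by positivity),
    h.logb_two_mul, h.logb_one_sub]
  ring

lemma hStar_eq (h : IsOptimalParam a r) {x : ℝ} (hx : 2 * a / (1 + a) ≤ x) (hx1 : x ≤ 1) :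
    hStar a r x = binEnt (x / 2) - x + (3 - x) * r / 2 := by
  have hcb := h.breakpoints_le
  unfold hStar
  rw [if_neg (by linarith)]
  split_ifs with hxb
  · obtain rfl := le_antisymm hx hxb
    rw [← branchTangent_self, ← h.cross_breakpoint]
    rfl
  · exact Bbranch_eq_s17 h.pos h.lt_one h.binEnt_eq (by linarith [h.breakpoint_pos]) (by linarith)

lemma hStar_one (h : IsOptimalParam a r) : hStar a r 1 = r := by
  rw [h.hStar_eq h.breakpoint_lt_one.le le_rfl]
  have : binEnt (1 / 2) = 1 := by
    have h2 : Real.logb 2 (1 / 2 : ℝ) = -1 := by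
      rw [one_div, Real.logb_inv, Real.logb_self_eq_one (by norm_num)]
    unfold binEnt
    norm_num at h2 ⊢
    rw [h2]
    norm_num
  rw [this]
  ring

lemma hStar_zero (h : IsOptimalParam a r) : hStar a r 0 = r := by
  rw [← h.hStar_one_sub, sub_zero, h.hStar_one]

/-- On the right branch, tangent lines to `h*` dominate it on all of `[0, 1]`. -/
lemma hStar_le_branchTangent (h : IsOptimalParam a r) {x y : ℝ} (hy : 2 * a / (1 + a) ≤ y)
    (hy1 : y ≤ 1) (hx0 : 0 ≤ x) (hx1 : x ≤ 1) : hStar a r x ≤ branchTangent r y x := by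
  have hb := h.breakpoint_pos
  have hb1 := h.breakpoint_lt_one
  rcases le_total (2 * a / (1 + a)) x with hx | hx
  · rw [h.hStar_eq hx hx1]
    exact le_branchTangent r hx0 (by linarith) (by linarith) (by linarith)
  · refine le_trans ?_ (branchTangent_le_branchTangent r hb hy (by linarith) hx)
    by_cases hc : x < (1 - a) / (1 + a)
    · have hx' := one_sub_breakpoint h.pos
      rw [← h.hStar_one_sub, h.hStar_eq (by linarith) (by linarith)]
      refine (le_branchTangent r (by linarith) (by linarith) hb (by linarith)).trans ?_
      rw [h.branchTangent_breakpoint, h.branchTangent_breakpoint]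
      have := h.half_lt_breakpoint
      nlinarith [h.logb_one_sub_le]
    · unfold hStar
      rw [if_neg hc, if_pos hx, ← h.cross_breakpoint]
      exact binEnt_le_cross hx0 hx1 hb hb1

lemma hStar_le_one_line (h : IsOptimalParam a r) {x : ℝ} (hx0 : 0 ≤ x) (hx1 : x ≤ 1) :
    hStar a r x ≤ r + (1 + r / 2) * (1 - x) := by
  refine (h.hStar_le_branchTangent h.breakpoint_lt_one.le le_rfl hx0 hx1).trans_eq ?_
  have h2 : Real.logb 2 (1 / 2 : ℝ) = -1 := by
    rw [one_div, Real.logb_inv, Real.logb_self_eq_one (by norm_num)]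
  have e : (1 : ℝ) - 1 / 2 = 1 / 2 := by norm_num
  unfold branchTangent
  rw [e, h2]
  ring

lemma hStar_le_zero_line (h : IsOptimalParam a r) {x : ℝ} (hx0 : 0 ≤ x) (hx1 : x ≤ 1) :
    hStar a r x ≤ r + (1 + r / 2) * x := by
  have := h.hStar_le_one_line (x := 1 - x) (by linarith) (by linarith)
  rw [h.hStar_one_sub] at this
  linarith

lemma gObj_symm (h : IsOptimalParam a r) (z δ γ : ℝ) :
    gObj a r (1 - z) γ δ = gObj a r z δ γ := by
  have e1 : 1 + (γ - (1 - z)) / (1 + γ - δ) = 1 - (1 - z - γ) / (1 + γ - δ) := by ring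
  have e2 : (1 - (1 - z) - δ) / (1 + δ - γ) = 1 - (1 + (δ - z) / (1 + δ - γ)) := by ring
  have e3 : 1 / 2 + (γ - δ) / 2 = 1 - (1 / 2 + (δ - γ) / 2) := by ring
  unfold gObj
  rw [e1, e2, e3, h.hStar_one_sub, h.hStar_one_sub, binEnt_one_sub]
  ring

lemma gammaStar_one_sub (h : IsOptimalParam a r) (z : ℝ) :
    gammaStar a (1 - z) = deltaStar a z := by
  have hb := one_sub_breakpoint h.pos
  have ha := h.pos
  unfold gammaStar deltaStar
  split_ifs with h1 h2 h2
  · obtain rfl : z = 2 * a / (1 + a) := by linarith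
    field_simp
    ring
  · ring
  · ring
  · linarith

lemma deltaStar_one_sub (h : IsOptimalParam a r) (z : ℝ) :
    deltaStar a (1 - z) = gammaStar a z := by
  rw [← h.gammaStar_one_sub, sub_sub_cancel]

end IsOptimalParam

/-- An affine upper bound on `f` over `[0, 1]` passes to the perspective of `f`. -/
lemma perspective_le {f : ℝ → ℝ} {A C s w : ℝ}
    (hf : ∀ x, 0 ≤ x → x ≤ 1 → f x ≤ A + C * x) (hw : 0 ≤ w) (hws : w ≤ s) :
    s * f (w / s) ≤ A * s + C * w := by
  rcases (hw.trans hws).eq_or_lt with hs | hs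
  · obtain rfl : w = 0 := by linarith
    simp [← hs]
  · calc s * f (w / s) ≤ s * (A + C * (w / s)) := by
          gcongr
          exact hf _ (by positivity) ((div_le_one hs).2 hws)
      _ = A * s + C * w := by field_simp

/-- Affine upper bounds on `h*` turn into a bound on the objective that is linear
in the actions apart from the entropy term. -/
lemma gObj_le_of_hStar_le {a r z δ γ A C A' C' : ℝ}
    (hf : ∀ x, 0 ≤ x → x ≤ 1 → hStar a r x ≤ A + C * x)
    (hg : ∀ x, 0 ≤ x → x ≤ 1 → hStar a r x ≤ A' + C' * x)
    (hδ0 : 0 ≤ δ) (hδ : δ ≤ z) (hγ0 : 0 ≤ γ) (hγ : γ ≤ 1 - z) :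
    gObj a r z δ γ ≤ binEnt ((1 + δ - γ) / 2) + δ + γ - 1
      + (A * (1 + δ - γ) + C * (1 + 2 * δ - γ - z)) / 2
      + (A' * (1 + γ - δ) + C' * (1 - z - γ)) / 2 := by
  have h1 : (1 + δ - γ) * hStar a r (1 + (δ - z) / (1 + δ - γ))
      ≤ A * (1 + δ - γ) + C * (1 + 2 * δ - γ - z) := by
    refine le_trans (le_of_eq ?_)
      (perspective_le (w := 1 + 2 * δ - γ - z) hf (by linarith) (by linarith))
    rcases eq_or_ne (1 + δ - γ) 0 with hs | hs
    · simp [hs]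
    · congr 2
      field_simp
      ring
  have h2 := perspective_le (s := 1 + γ - δ) (w := 1 - z - γ) hg (by linarith) (by linarith)
  have e : 1 / 2 + (δ - γ) / 2 = (1 + δ - γ) / 2 := by ring
  unfold gObj
  rw [e]
  linarith

namespace IsOptimalParam

variable {a r : ℝ}

lemma gObj_le_middle (h : IsOptimalParam a r) {z δ γ : ℝ} (hzc : (1 - a) / (1 + a) ≤ z)
    (hzb : z ≤ 2 * a / (1 + a)) (hδ0 : 0 ≤ δ) (hδ : δ ≤ z) (hγ0 : 0 ≤ γ) (hγ : γ ≤ 1 - z) :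
    gObj a r z δ γ ≤ gObj a r z z (1 - z) := by
  have ha := h.pos
  have ha1 := h.lt_one
  have h1a : 0 < 1 - a := by linarith
  have hz0 : 0 < z := lt_of_lt_of_le (by positivity) hzc
  have hz1 : z < 1 := hzb.trans_lt h.breakpoint_lt_one
  have hval : gObj a r z z (1 - z) = binEnt z + r := by
    have e1 : 1 / 2 + (z - (1 - z)) / 2 = z := by ring
    unfold gObj
    rw [e1]
    simp only [sub_self, zero_div, add_zero, h.hStar_one, h.hStar_zero]
    ring
  have hbound := gObj_le_of_hStar_le (A := r + (1 + r / 2)) (C := -(1 + r / 2))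
    (fun x h0 h1 => (h.hStar_le_one_line h0 h1).trans_eq (by ring))
    (fun x h0 h1 => h.hStar_le_zero_line h0 h1) hδ0 hδ hγ0 hγ
  have hent := binEnt_le_cross (x := (1 + δ - γ) / 2) (q := z) (by linarith) (by linarith) hz0 hz1
  rw [hval]
  refine hbound.trans ?_
  have l1 : Real.logb 2 z + Real.logb 2 (1 - a) ≤ Real.logb 2 (1 - z) + Real.logb 2 (2 * a) := by
    rw [← Real.logb_mul hz0.ne' h1a.ne', ← Real.logb_mul (by linarith) (by positivity)]
    rw [le_div_iff₀ (by positivity)] at hzb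
    exact Real.logb_le_logb_of_le (by norm_num) (by positivity) (by linarith)
  have l2 : Real.logb 2 (1 - z) + Real.logb 2 (1 - a) ≤ Real.logb 2 z + Real.logb 2 (2 * a) := by
    rw [← Real.logb_mul (by linarith) h1a.ne', ← Real.logb_mul hz0.ne' (by positivity)]
    rw [div_le_iff₀ (by positivity)] at hzc
    exact Real.logb_le_logb_of_le (by norm_num) (mul_pos (by linarith) h1a) (by linarith)
  rw [h.logb_one_sub, h.logb_two_mul] at l1 l2
  unfold binEnt at hent ⊢
  nlinarith [mul_nonneg (sub_nonneg.2 hδ) (sub_nonneg.2 l1),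
    mul_nonneg (sub_nonneg.2 hγ) (sub_nonneg.2 l2)]

lemma gObj_le_right (h : IsOptimalParam a r) {z δ γ : ℝ} (hzb : 2 * a / (1 + a) ≤ z)
    (hz1 : z ≤ 1) (hδ0 : 0 ≤ δ) (hδ : δ ≤ z) (hγ0 : 0 ≤ γ) (hγ : γ ≤ 1 - z) :
    gObj a r z δ γ ≤ gObj a r z (a * (2 - z)) (1 - z) := by
  have ha := h.pos
  have ha1 := h.lt_one
  have h1a : 0 < 1 - a := by linarith
  have hz0 : 0 < z := h.breakpoint_pos.trans_le hzb
  have hzh : 1 / 2 < z := h.half_lt_breakpoint.trans_le hzb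
  have h2z : 0 < 2 - z := by linarith
  have hzb' : 2 * a ≤ z * (1 + a) := (div_le_iff₀ (by positivity)).1 hzb
  obtain ⟨m, hm⟩ : ∃ m, m = 2 * a + (1 - a) * z := ⟨_, rfl⟩
  have hm0 : 0 < m := by rw [hm]; positivity
  have hm2 : m < 2 := by rw [hm]; nlinarith
  obtain ⟨y, hy⟩ : ∃ y, y = 2 * a * (2 - z) / m := ⟨_, rfl⟩
  have hyb : 2 * a / (1 + a) ≤ y := by
    rw [hy, div_le_div_iff₀ (by positivity) hm0, hm]
    nlinarith [mul_nonneg ha.le (sub_nonneg.2 hz1)]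
  have hy1 : y ≤ 1 := by
    rw [hy, div_le_one hm0, hm]
    linarith
  have ey1 : y / 2 = a * (2 - z) / m := by rw [hy]; field_simp
  have ey2 : 1 - y / 2 = z / m := by
    rw [ey1]
    field_simp
    rw [hm]
    ring
  have em : 1 - m / 2 = (1 - a) * (2 - z) / 2 := by rw [hm]; ring
  have L1 : Real.logb 2 (y / 2) = -(2 * r) + Real.logb 2 (2 - z) - Real.logb 2 m := by
    rw [ey1, Real.logb_div (by positivity) hm0.ne', Real.logb_mul ha.ne' h2z.ne', h.logb_self]
  have L2 : Real.logb 2 (1 - y / 2) = Real.logb 2 z - Real.logb 2 m := by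
    rw [ey2, Real.logb_div hz0.ne' hm0.ne']
  have l2 : Real.logb 2 2 = 1 := Real.logb_self_eq_one (by norm_num)
  have L3 : Real.logb 2 (m / 2) = Real.logb 2 m - 1 := by
    rw [Real.logb_div hm0.ne' two_ne_zero, l2]
  have L4 : Real.logb 2 (1 - m / 2) = -(3 / 2 * r) + Real.logb 2 (2 - z) - 1 := by
    rw [em, Real.logb_div (by positivity) two_ne_zero, Real.logb_mul h1a.ne' h2z.ne',
      h.logb_one_sub, l2]
  have hval : gObj a r z (a * (2 - z)) (1 - z) = binEnt (m / 2) + a * (2 - z) + (1 - z) - 1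
      + m / 2 * branchTangent r y y + (2 - m) / 2 * r := by
    have e1 : 1 / 2 + (a * (2 - z) - (1 - z)) / 2 = m / 2 := by rw [hm]; ring
    have e2 : 1 + a * (2 - z) - (1 - z) = m := by rw [hm]; ring
    have e3 : 1 - a * (2 - z) + (1 - z) = 2 - m := by rw [hm]; ring
    have e4 : 1 + (a * (2 - z) - z) / m = y := by
      rw [hy]
      field_simp
      rw [hm]
      ring
    unfold gObj
    rw [e1, e2, e3, e4, sub_self, zero_div, h.hStar_zero, h.hStar_eq hyb hy1, branchTangent_self]
  have hbound := gObj_le_of_hStar_le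
    (A := -Real.logb 2 (1 - y / 2) + 3 * r / 2)
    (C := (Real.logb 2 (1 - y / 2) - Real.logb 2 (y / 2)) / 2 - 1 - r / 2)
    (fun x h0 h1 => (h.hStar_le_branchTangent hyb hy1 h0 h1).trans_eq (by
      unfold branchTangent; ring))
    (fun x h0 h1 => h.hStar_le_zero_line h0 h1) hδ0 hδ hγ0 hγ
  have hent := binEnt_le_cross (x := (1 + δ - γ) / 2) (q := m / 2) (by linarith) (by linarith)
    (by linarith) (by linarith)
  have hmy : m * y = 2 * a * (2 - z) := by rw [hy]; field_simp
  have hlog : Real.logb 2 (2 - z) ≤ 2 + Real.logb 2 z := by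
    have h4 : Real.logb 2 4 = 2 := by
      rw [show (4 : ℝ) = 2 ^ 2 by norm_num, Real.logb_pow, l2]
      norm_num
    have h4z := Real.logb_mul (b := 2) (four_ne_zero (α := ℝ)) hz0.ne'
    rw [h4] at h4z
    rw [← h4z]
    exact Real.logb_le_logb_of_le (by norm_num) h2z (by linarith)
  rw [hval]
  refine hbound.trans ?_
  have hγ' := mul_nonneg (sub_nonneg.2 hγ) (sub_nonneg.2 hlog)
  have hexpand : m / 2 * branchTangent r y y
      = -(a * (2 - z) / 2 * Real.logb 2 (y / 2))
        - (m / 2 - a * (2 - z) / 2) * Real.logb 2 (1 - y / 2) - a * (2 - z)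
        + (3 * m - 2 * a * (2 - z)) * r / 4 := by
    unfold branchTangent
    linear_combination (-(Real.logb 2 (y / 2)) / 4 + Real.logb 2 (1 - y / 2) / 4 - 1 / 2 - r / 4)
      * hmy
  rw [hexpand]
  unfold binEnt at hent ⊢
  rw [L3, L4] at hent ⊢
  rw [L1, L2]
  generalize Real.logb 2 m = M at hent ⊢
  rw [hm]
  linarith

lemma gObj_le (h : IsOptimalParam a r) {z δ γ : ℝ} (hz : 1 / 2 ≤ z) (hz1 : z ≤ 1)
    (hδ0 : 0 ≤ δ) (hδ : δ ≤ z) (hγ0 : 0 ≤ γ) (hγ : γ ≤ 1 - z) :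
    gObj a r z δ γ ≤ gObj a r z (deltaStar a z) (gammaStar a z) := by
  have hb := one_sub_breakpoint h.pos
  have hhalf := h.half_lt_breakpoint
  have hγs : gammaStar a z = 1 - z := if_neg (by linarith)
  rw [hγs]
  unfold deltaStar
  split_ifs with hzb
  · exact h.gObj_le_middle (by linarith) hzb hδ0 hδ hγ0 hγ
  · exact h.gObj_le_right (by linarith) hz1 hδ0 hδ hγ0 hγ

end IsOptimalParam

theorem optimal_policy_maximizes (a : ℝ) (ha : a ∈ Set.Ioo (0 : ℝ) 1)
    (haroot : a ^ 4 - 5 * a ^ 3 + 6 * a ^ 2 - 4 * a + 1 = 0)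
    (hauniq : ∀ x ∈ Set.Ioo (0 : ℝ) 1,
      x ^ 4 - 5 * x ^ 3 + 6 * x ^ 2 - 4 * x + 1 = 0 → x = a) :
    ∀ z ∈ Set.Icc (0 : ℝ) 1, ∀ δ γ : ℝ,
      0 ≤ δ → δ ≤ z → 0 ≤ γ → γ ≤ 1 - z →
      gObj a (2 * binEnt a / (3 + a)) z δ γ
        ≤ gObj a (2 * binEnt a / (3 + a)) z (deltaStar a z) (gammaStar a z) := by
  intro z hz δ γ hδ0 hδ hγ0 hγ
  have h := IsOptimalParam.of_root ha haroot
  rcases le_total (1 / 2) z with hz2 | hz2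
  · exact h.gObj_le hz2 hz.2 hδ0 hδ hγ0 hγ
  · rw [← h.gObj_symm z δ γ, ← h.gObj_symm z (deltaStar a z), ← h.gammaStar_one_sub,
      ← h.deltaStar_one_sub]
    exact h.gObj_le (by linarith) (by linarith [hz.1]) hγ0 hγ hδ0 (by linarith)
end

section
/- For every z ∈ [0,1], the supremum of g_z(δ,γ) over all (δ,γ) with 0 ≤ δ ≤ z and 0 ≤ γ ≤ 1-z equals h*(z) + ρ, and this supremum is attained; i.e., the pair (ρ, h*) solves the Bellman equation ρ + h*(z) = sup_{δ,γ} g_z(δ,γ) for the Ising-channel dynamic program, so the optimal average reward (the feedback capacity of the Ising channel) equals ρ = 2H_b(a)/(3+a) ≈ 0.575522. -/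
open Real

/-- Gibbs' inequality for two outcomes. -/
theorem binEnt_le_crossEntropy {w m : ℝ} (hw : w ∈ Set.Icc (0 : ℝ) 1)
    (hm : m ∈ Set.Ioo (0 : ℝ) 1) :
    binEnt w ≤ -(w * logb 2 m) - (1 - w) * logb 2 (1 - m) := by
  have gibbs_term : ∀ x y : ℝ, 0 ≤ x → 0 < y → x * (log y - log x) ≤ y - x := by
    intro x y hx hy
    rcases hx.eq_or_lt with rfl | hx
    · simpa using hy.le
    · have h := log_le_sub_one_of_pos (div_pos hy hx)
      rw [log_div hy.ne' hx.ne'] at h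
      calc x * (log y - log x) ≤ x * (y / x - 1) := mul_le_mul_of_nonneg_left h hx.le
        _ = y - x := by field_simp
  have h1 := gibbs_term w m hw.1 hm.1
  have h2 := gibbs_term (1 - w) (1 - m) (by linarith [hw.2]) (by linarith [hm.2])
  have hlog : (0 : ℝ) < log 2 := log_pos (by norm_num)
  have key : w * (log m - log w) + (1 - w) * (log (1 - m) - log (1 - w)) ≤ 0 := by linarith
  have h3 := div_nonpos_of_nonpos_of_nonneg key hlog.le
  have h4 : (w * (log m - log w) + (1 - w) * (log (1 - m) - log (1 - w))) / log 2
      = binEnt w - (-(w * logb 2 m) - (1 - w) * logb 2 (1 - m)) := by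
    simp only [binEnt, logb]
    ring
  linarith

theorem hStar_one_sub {a : ℝ} (ρ : ℝ) (ha : 1 / 3 < a) (w : ℝ) :
    hStar a ρ (1 - w) = hStar a ρ w := by
  have hb : (1 - a) / (1 + a) = 1 - 2 * a / (1 + a) := by
    field_simp
    ring
  have hb2 : 1 / 2 < 2 * a / (1 + a) := by
    rw [lt_div_iff₀ (by linarith)]
    linarith
  have hent : binEnt (1 - w) = binEnt w := by
    simp only [binEnt, sub_sub_cancel]
    ring
  unfold hStar
  rw [hb, hent, sub_sub_cancel]
  split_ifs <;> first | rfl | (exfalso; linarith)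

theorem gObj_swap {a : ℝ} (ρ : ℝ) (ha : 1 / 3 < a) (z δ γ : ℝ) :
    gObj a ρ (1 - z) γ δ = gObj a ρ z δ γ := by
  have h1 : 1 + (γ - (1 - z)) / (1 + γ - δ) = 1 - (1 - z - γ) / (1 + γ - δ) := by ring
  have h2 : (1 + δ - γ) / 2 * hStar a ρ ((1 - (1 - z) - δ) / (1 + δ - γ))
      = (1 + δ - γ) / 2 * hStar a ρ (1 + (δ - z) / (1 + δ - γ)) := by
    rw [← hStar_one_sub ρ ha ((1 - (1 - z) - δ) / (1 + δ - γ))]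
    congr 2
    ring
  have h3 : binEnt (1 / 2 + (γ - δ) / 2) = binEnt (1 / 2 + (δ - γ) / 2) := by
    have e1 : 1 - (1 / 2 + (γ - δ) / 2) = 1 / 2 + (δ - γ) / 2 := by ring
    have e2 : 1 - (1 / 2 + (δ - γ) / 2) = 1 / 2 + (γ - δ) / 2 := by ring
    simp only [binEnt, e1, e2]
    ring
  unfold gObj
  rw [h1, hStar_one_sub ρ ha]
  rw [show 1 - γ + δ = 1 + δ - γ by ring, h2, h3]
  ring

/-- The relations between `a` and `ρ` used throughout. They express `a = t ^ 4`, `1 - a = t ^ 3`,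
`ρ = -2 log₂ t`. -/
structure IsingParams (a ρ : ℝ) : Prop where
  lower : 2 / 5 < a
  upper : a < 1 / 2
  logb_a : logb 2 a = -2 * ρ
  logb_one_sub : logb 2 (1 - a) = -(3 / 2) * ρ

theorem isingParams_of_root {a : ℝ} (ha : a ∈ Set.Ioo (0 : ℝ) 1)
    (haroot : a ^ 4 - 5 * a ^ 3 + 6 * a ^ 2 - 4 * a + 1 = 0) :
    IsingParams a (2 * binEnt a / (3 + a)) := by
  obtain ⟨h0, h1⟩ := ha
  have hpow : a ^ 3 = (1 - a) ^ 4 := by linear_combination -haroot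
  have hlog : 3 * logb 2 a = 4 * logb 2 (1 - a) := by
    have h := congrArg (logb 2) hpow
    rw [logb_pow, logb_pow] at h
    exact_mod_cast h
  have hpos : 3 + a ≠ 0 := by linarith
  refine ⟨?_, ?_, ?_, ?_⟩
  · by_contra! h
    have h2 : a ^ 3 ≤ (2 / 5) ^ 3 := by gcongr
    have h3 : (3 / 5 : ℝ) ^ 4 ≤ (1 - a) ^ 4 := by
      gcongr
      linarith
    norm_num at h2 h3
    linarith
  · by_contra! h
    have h2 : (1 / 2 : ℝ) ^ 3 ≤ a ^ 3 := by gcongr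
    have h3 : (1 - a) ^ 4 ≤ (1 / 2 : ℝ) ^ 4 := by
      gcongr
      linarith
    norm_num at h2 h3
    linarith
  · unfold binEnt
    field_simp
    linear_combination (1 - a) * hlog
  · unfold binEnt
    field_simp
    linear_combination -a * hlog

namespace IsingParams

variable {a ρ : ℝ}

theorem third_lt (h : IsingParams a ρ) : 1 / 3 < a := by linarith [h.lower]

theorem rho_pos (h : IsingParams a ρ) : 0 < ρ := by
  have h1 := h.logb_a
  have : logb 2 a < 0 :=
    logb_neg (by norm_num) (by linarith [h.lower]) (by linarith [h.upper])
  linarith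

theorem Bbranch_eq (h : IsingParams a ρ) {z : ℝ} (hz : 0 < z) (hz1 : z ≤ 1) :
    Bbranch a ρ z = binEnt (z / 2) - z + ρ * (3 - z) / 2 := by
  have h0 := h.lower
  have h1 := h.upper
  have ha : 0 < a := by linarith
  have ha1 : 0 < 1 - a := by linarith
  have hz2 : 0 < 1 - z / 2 := by linarith
  set P := (2 * a + (1 - a) * z) / 2 with hP
  have hPpos : 0 < P := by
    have := mul_pos ha1 hz
    linarith
  have e1 : 1 - P = (1 - a) * (1 - z / 2) := by rw [hP]; ring
  have e2 : 2 * a / (a * (2 - z) + z) = a / P := by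
    rw [show a * (2 - z) + z = 2 * P by rw [hP]; ring]
    field_simp
  have e3 : 1 - a / P = (1 - a) * (z / 2) / P := by
    rw [eq_div_iff hPpos.ne', sub_mul, div_mul_cancel₀ _ hPpos.ne', hP]
    ring
  have e4 : (2 * a + (1 - a) * z) / (2 * (1 - a)) = P / (1 - a) := by
    rw [hP]
    field_simp
  unfold Bbranch
  rw [e2, e4, ← hP]
  simp only [binEnt, e1, e3]
  rw [logb_mul ha1.ne' hz2.ne', logb_div ha.ne' hPpos.ne',
    logb_div (mul_pos ha1 (half_pos hz)).ne' hPpos.ne', logb_mul ha1.ne' (half_pos hz).ne',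
    h.logb_a, h.logb_one_sub]
  field_simp
  rw [hP]
  ring

theorem binEnt_le_branch (h : IsingParams a ρ) {w : ℝ} (hw : w ∈ Set.Ioo (0 : ℝ) 1) :
    binEnt w ≤ binEnt (w / 2) - w + ρ * (3 - w) / 2 := by
  obtain ⟨hw0, hw1⟩ := hw
  have h2 : 0 < 2 - w := by linarith
  have h3 : 0 < 1 - w := by linarith
  have hle : w / (2 - w) ≤ 1 := by
    rw [div_le_one h2]
    linarith
  have key := binEnt_le_crossEntropy (w := w / (2 - w)) (m := a)
    ⟨by positivity, hle⟩ ⟨by linarith [h.lower], by linarith [h.upper]⟩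
  have e1 : 1 - w / (2 - w) = 2 * (1 - w) / (2 - w) := by
    field_simp
    ring
  have e2 : 1 - w / 2 = (2 - w) / 2 := by ring
  have l2 : logb 2 2 = 1 := logb_self_eq_one (by norm_num)
  simp only [binEnt, e1, e2] at key ⊢
  rw [logb_div hw0.ne' h2.ne', logb_div (by positivity) h2.ne',
    logb_mul two_ne_zero h3.ne', l2, h.logb_a, h.logb_one_sub] at key
  rw [logb_div hw0.ne' two_ne_zero, logb_div h2.ne' two_ne_zero, l2]
  have key2 := mul_le_mul_of_nonneg_left key (half_pos h2).le
  have e3 : (2 - w) / 2 * (w / (2 - w)) = w / 2 := by field_simp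
  have e4 : (2 - w) / 2 * (2 * (1 - w) / (2 - w)) = 1 - w := by field_simp
  linear_combination key2 + (logb 2 w - logb 2 (2 - w) + 2 * ρ) * e3 +
    (1 + logb 2 (1 - w) - logb 2 (2 - w) + 3 / 2 * ρ) * e4

theorem branch_le_tangent (ρ : ℝ) {w m : ℝ} (hw : w ∈ Set.Icc (0 : ℝ) 1)
    (hm : m ∈ Set.Ioo (0 : ℝ) 1) :
    binEnt (w / 2) - w + ρ * (3 - w) / 2
      ≤ (-(logb 2 m + logb 2 (1 - m)) / 2 - 1 + ρ) * w
        + (-logb 2 (1 - m) + 3 / 2 * ρ) * (1 - w) := by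
  have := binEnt_le_crossEntropy (w := w / 2) (m := m)
    ⟨by linarith [hw.1], by linarith [hw.2, hw.1]⟩ hm
  linarith

/-- `h*` lies below the tangents of its right branch. -/
theorem hStar_le_tangent (h : IsingParams a ρ) {w m : ℝ} (hw : w ∈ Set.Icc (0 : ℝ) 1)
    (hm : m ∈ Set.Icc (a / (1 + a)) (1 / 2)) :
    hStar a ρ w ≤ (-(logb 2 m + logb 2 (1 - m)) / 2 - 1 + ρ) * w
        + (-logb 2 (1 - m) + 3 / 2 * ρ) * (1 - w) := by
  have h0 := h.lower
  have h1 := h.upper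
  have ha : 0 < a := by linarith
  have hm0 : 0 < m := lt_of_lt_of_le (by positivity) hm.1
  have hm1 : m ∈ Set.Ioo (0 : ℝ) 1 := ⟨hm0, by linarith [hm.2]⟩
  have hb : 1 / 2 < 2 * a / (1 + a) := by
    rw [lt_div_iff₀ (by linarith)]
    linarith
  have hb1 : 2 * a / (1 + a) < 1 := by
    rw [div_lt_one (by linarith)]
    linarith
  have hsub : (1 - a) / (1 + a) = 1 - 2 * a / (1 + a) := by
    field_simp
    ring
  unfold hStar
  rw [hsub]
  split_ifs with hl hr
  · rw [h.Bbranch_eq (by linarith) (by linarith [hw.1])]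
    refine (branch_le_tangent ρ ⟨by linarith [hw.2], by linarith [hw.1]⟩ hm1).trans ?_
    have hma : a * (1 - m) ≤ m := by
      have := (div_le_iff₀ (by linarith : 0 < 1 + a)).1 hm.1
      linarith
    have hpos : 0 < 1 - m := by linarith [hm.2]
    have hlog := logb_le_logb_of_le (b := 2) (by norm_num) (mul_pos ha hpos) hma
    rw [logb_mul ha.ne' hpos.ne'] at hlog
    have hquart := logb_le_logb_of_le (b := 2) (by norm_num)
      (by norm_num : (0 : ℝ) < 2 ^ (-2 : ℝ)) (by norm_num; linarith : (2 : ℝ) ^ (-2 : ℝ) ≤ a)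
    rw [logb_rpow (by norm_num) (by norm_num)] at hquart
    have hρ := h.rho_pos
    have hw2 : 0 ≤ 1 - 2 * w := by linarith
    have hslope : 0 ≤ (logb 2 m - logb 2 (1 - m)) / 2 + 1 + ρ / 2 := by linarith
    have := mul_nonneg hw2 hslope
    linarith
  · exact (h.binEnt_le_branch ⟨by linarith, by linarith⟩).trans (branch_le_tangent ρ hw hm1)
  · rw [h.Bbranch_eq (by linarith) hw.2]
    exact branch_le_tangent ρ hw hm1

theorem logb_two_half : logb 2 (1 / 2 : ℝ) = -1 := by
  rw [one_div, logb_inv, logb_self_eq_one (by norm_num)]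

theorem hStar_eq_branch (h : IsingParams a ρ) {w : ℝ} (hw : 2 * a / (1 + a) ≤ w) (hw1 : w ≤ 1) :
    hStar a ρ w = binEnt (w / 2) - w + ρ * (3 - w) / 2 := by
  have h0 := h.lower
  have h1 := h.upper
  have ha : 0 < a := by linarith
  have ha1 : 0 < 1 - a := by linarith
  have ha2 : 0 < 1 + a := by linarith
  have hlt : (1 - a) / (1 + a) < 2 * a / (1 + a) := by
    gcongr
    linarith
  have hbpos : 0 < 2 * a / (1 + a) := by positivity
  unfold hStar
  rw [if_neg (by linarith)]
  split_ifs with hr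
  · obtain rfl := le_antisymm hw hr
    have l2 : logb 2 2 = 1 := logb_self_eq_one (by norm_num)
    have e1 : 1 - 2 * a / (1 + a) = (1 - a) / (1 + a) := by
      field_simp
      ring
    have e2 : 2 * a / (1 + a) / 2 = a / (1 + a) := by ring
    have e3 : 1 - a / (1 + a) = 1 / (1 + a) := by
      field_simp
      ring
    simp only [binEnt, e1, e2, e3]
    rw [logb_div (by positivity) ha2.ne', logb_div ha1.ne' ha2.ne', logb_div ha.ne' ha2.ne',
      logb_div one_ne_zero ha2.ne', logb_mul two_ne_zero ha.ne', l2, logb_one, h.logb_a,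
      h.logb_one_sub]
    field_simp
    ring
  · exact h.Bbranch_eq (by linarith) hw1

theorem hStar_one (h : IsingParams a ρ) : hStar a ρ 1 = ρ := by
  have hb : 2 * a / (1 + a) ≤ 1 := by
    rw [div_le_one (by linarith [h.lower])]
    linarith [h.upper]
  have e : (1 - 1 / 2 : ℝ) = 1 / 2 := by norm_num
  rw [h.hStar_eq_branch hb le_rfl]
  simp only [binEnt, e, logb_two_half]
  ring

theorem hStar_zero (h : IsingParams a ρ) : hStar a ρ 0 = ρ := by
  rw [← hStar_one_sub ρ h.third_lt, sub_zero, h.hStar_one]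

/-- Linear majorant of the objective, obtained from the tangent of `h*` at `2 * m` (respectively
`0`) in the first (respectively second) term. -/
theorem gObj_le (h : IsingParams a ρ) {z δ γ c m : ℝ}
    (hδ : 0 ≤ δ) (hδz : δ ≤ z) (hγ : 0 ≤ γ) (hγz : γ ≤ 1 - z)
    (hc : c ∈ Set.Ioo (0 : ℝ) 1) (hm : m ∈ Set.Icc (a / (1 + a)) (1 / 2)) :
    gObj a ρ z δ γ ≤ -((1 + δ - γ) / 2 * logb 2 c) - (1 - δ + γ) / 2 * logb 2 (1 - c) + δ + γ - 1
      + (-(logb 2 m + logb 2 (1 - m)) / 2 - 1 + ρ) * ((1 + δ - γ + δ - z) / 2)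
      + (-logb 2 (1 - m) + 3 / 2 * ρ) * ((z - δ) / 2)
      + ρ * ((z - δ + 2 * γ) / 2) + (1 + 3 / 2 * ρ) * ((1 - z - γ) / 2) := by
  have scaled : ∀ {P u A B : ℝ}, 0 ≤ u → u ≤ P →
      (∀ w ∈ Set.Icc (0 : ℝ) 1, hStar a ρ w ≤ A * w + B * (1 - w)) →
      P / 2 * hStar a ρ (u / P) ≤ A * (u / 2) + B * ((P - u) / 2) := by
    intro P u A B hu huP hT
    rcases (hu.trans huP).eq_or_lt with rfl | hP
    · obtain rfl := le_antisymm huP hu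
      simp
    · have hmul := mul_le_mul_of_nonneg_left
        (hT (u / P) ⟨div_nonneg hu hP.le, (div_le_one hP).2 huP⟩) (half_pos hP).le
      refine hmul.trans_eq ?_
      field_simp
  have ha : 0 < a := by linarith [h.lower]
  have hhalf : (1 / 2 : ℝ) ∈ Set.Icc (a / (1 + a)) (1 / 2) := by
    refine ⟨?_, le_rfl⟩
    rw [div_le_iff₀ (by linarith)]
    linarith [h.upper]
  have hE := binEnt_le_crossEntropy (w := 1 / 2 + (δ - γ) / 2) (m := c)
    ⟨by linarith, by linarith⟩ hc
  have hfirst := scaled (P := 1 + δ - γ) (u := 1 + δ - γ + δ - z) (by linarith) (by linarith)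
    fun w hw => h.hStar_le_tangent hw hm
  have hsecond := scaled (P := 1 + γ - δ) (u := 1 - z - γ) (A := 1 + 3 / 2 * ρ) (B := ρ)
    (by linarith) (by linarith) (by
      intro w hw
      rw [← hStar_one_sub ρ h.third_lt]
      have := h.hStar_le_tangent (w := 1 - w) ⟨by linarith [hw.2], by linarith [hw.1]⟩ hhalf
      rw [show (1 - 1 / 2 : ℝ) = 1 / 2 by norm_num, logb_two_half] at this
      linarith)
  have harg : (1 + δ - γ) / 2 * hStar a ρ (1 + (δ - z) / (1 + δ - γ))
      ≤ (-(logb 2 m + logb 2 (1 - m)) / 2 - 1 + ρ) * ((1 + δ - γ + δ - z) / 2)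
        + (-logb 2 (1 - m) + 3 / 2 * ρ) * ((z - δ) / 2) := by
    rcases eq_or_ne (1 + δ - γ) 0 with h0 | h0
    · have hδ0 : δ = 0 := by linarith
      have hz0 : z = 0 := by linarith
      rw [h0, hδ0, hz0]
      simp
    · rw [show 1 + (δ - z) / (1 + δ - γ) = (1 + δ - γ + δ - z) / (1 + δ - γ) by
        field_simp; ring]
      exact hfirst.trans_eq (by ring)
  unfold gObj
  rw [show 1 - δ + γ = 1 + γ - δ by ring]
  linarith

theorem isGreatest_of_mem_middle (h : IsingParams a ρ) {z : ℝ} (hz : (1 - a) / (1 + a) ≤ z)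
    (hz1 : z ≤ 2 * a / (1 + a)) :
    IsGreatest {v : ℝ | ∃ δ γ : ℝ, 0 ≤ δ ∧ δ ≤ z ∧ 0 ≤ γ ∧ γ ≤ 1 - z ∧ v = gObj a ρ z δ γ}
      (hStar a ρ z + ρ) := by
  have h0 := h.lower
  have h1 := h.upper
  have ha : 0 < a := by linarith
  have ha1 : 0 < 1 - a := by linarith
  have ha2 : 0 < 1 + a := by linarith
  have hzpos : 0 < z := lt_of_lt_of_le (by positivity) hz
  rw [div_le_iff₀ ha2] at hz
  have hz' := hz1
  rw [le_div_iff₀ ha2] at hz1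
  have hzlt : 0 < 1 - z := by nlinarith
  have hval : hStar a ρ z = binEnt z := by
    unfold hStar
    rw [if_neg (by rw [not_lt, div_le_iff₀ ha2]; exact hz), if_pos hz']
  rw [hval]
  constructor
  · refine ⟨z, 1 - z, hzpos.le, le_rfl, hzlt.le, le_rfl, ?_⟩
    unfold gObj
    rw [sub_self, sub_self, zero_div, zero_div, add_zero, h.hStar_one, h.hStar_zero,
      show 1 / 2 + (z - (1 - z)) / 2 = z by ring]
    ring
  · rintro v ⟨δ, γ, hδ, hδz, hγ, hγz, rfl⟩
    have hhalf : (1 / 2 : ℝ) ∈ Set.Icc (a / (1 + a)) (1 / 2) := by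
      refine ⟨?_, le_rfl⟩
      rw [div_le_iff₀ ha2]
      linarith
    refine (h.gObj_le hδ hδz hγ hγz ⟨hzpos, by linarith⟩ hhalf).trans ?_
    rw [show (1 - 1 / 2 : ℝ) = 1 / 2 by norm_num, logb_two_half]
    have l2 : logb 2 2 = 1 := logb_self_eq_one (by norm_num)
    have slope : ∀ {x y : ℝ}, 0 < x → 0 < y → x * (1 - a) ≤ 2 * a * y →
        logb 2 x - logb 2 y - 1 + ρ / 2 ≤ 0 := by
      intro x y hx hy hxy
      have := logb_le_logb_of_le (b := 2) (by norm_num) (mul_pos hx ha1) hxy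
      rw [logb_mul hx.ne' ha1.ne', logb_mul (by positivity) hy.ne', logb_mul two_ne_zero ha.ne',
        l2, h.logb_a, h.logb_one_sub] at this
      linarith
    have hx := mul_nonneg_of_nonpos_of_nonpos (by linarith : δ - z ≤ 0)
      (slope hzpos hzlt (by linarith))
    have hy := mul_nonneg_of_nonpos_of_nonpos (by linarith : γ - (1 - z) ≤ 0)
      (slope hzlt hzpos (by linarith))
    unfold binEnt
    linarith

theorem isGreatest_of_right (h : IsingParams a ρ) {z : ℝ} (hz : 2 * a / (1 + a) ≤ z)
    (hz1 : z ≤ 1) :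
    IsGreatest {v : ℝ | ∃ δ γ : ℝ, 0 ≤ δ ∧ δ ≤ z ∧ 0 ≤ γ ∧ γ ≤ 1 - z ∧ v = gObj a ρ z δ γ}
      (hStar a ρ z + ρ) := by
  have h0 := h.lower
  have h1 := h.upper
  have ha : 0 < a := by linarith
  have ha1 : 0 < 1 - a := by linarith
  have ha2 : 0 < 1 + a := by linarith
  have hzpos : 0 < z := lt_of_lt_of_le (by positivity) hz
  have hz2 : 0 < 1 - z / 2 := by linarith
  rw [h.hStar_eq_branch hz hz1]
  rw [div_le_iff₀ ha2] at hz
  set P := a * (1 - z / 2) + z / 2 with hP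
  have hPpos : 0 < P := by positivity
  have e1 : 1 - P = (1 - a) * (1 - z / 2) := by rw [hP]; ring
  have hPlt : 0 < 1 - P := by rw [e1]; positivity
  set m := a * (1 - z / 2) / P with hm
  have e2 : 1 - m = z / 2 / P := by
    rw [hm, eq_div_iff hPpos.ne', sub_mul, div_mul_cancel₀ _ hPpos.ne', hP]
    ring
  have hmP : P * m = a * (1 - z / 2) := by
    rw [hm]
    field_simp
  have hmlow : a / (1 + a) ≤ m := by
    rw [hm, div_le_div_iff₀ ha2 hPpos, hP]
    have := mul_nonneg ha.le (by linarith : 0 ≤ 1 - z)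
    nlinarith
  have hmhalf : m ≤ 1 / 2 := by
    rw [hm, div_le_iff₀ hPpos, hP]
    linarith
  have lm : logb 2 m = -2 * ρ + logb 2 (1 - z / 2) - logb 2 P := by
    rw [hm, logb_div (by positivity) hPpos.ne', logb_mul ha.ne' hz2.ne', h.logb_a]
  have lm1 : logb 2 (1 - m) = logb 2 (z / 2) - logb 2 P := by
    rw [e2, logb_div (by positivity) hPpos.ne']
  have lP1 : logb 2 (1 - P) = -(3 / 2) * ρ + logb 2 (1 - z / 2) := by
    rw [e1, logb_mul ha1.ne' hz2.ne', h.logb_one_sub]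
  constructor
  · refine ⟨a * (2 - z), 1 - z, by nlinarith, by linarith, by linarith, le_rfl, ?_⟩
    have hden : 1 + a * (2 - z) - (1 - z) = 2 * P := by rw [hP]; ring
    have harg : 1 + (a * (2 - z) - z) / (2 * P) = 2 * m := by
      rw [hm]
      field_simp
      rw [hP]
      ring
    unfold gObj
    rw [hden, harg, sub_self, zero_div, h.hStar_zero,
      h.hStar_eq_branch (by rw [mul_div_assoc]; linarith) (by linarith),
      show 1 / 2 + (a * (2 - z) - (1 - z)) / 2 = P by rw [hP]; ring,
      show 2 * m / 2 = m by ring]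
    unfold binEnt
    rw [lm, lm1, lP1]
    clear_value m P
    subst hP
    linear_combination (2 - ρ - logb 2 (z / 2) + logb 2 (1 - z / 2)) * hmP
  · rintro v ⟨δ, γ, hδ, hδz, hγ, hγz, rfl⟩
    refine (h.gObj_le hδ hδz hγ hγz ⟨hPpos, by linarith⟩ ⟨hmlow, hmhalf⟩).trans ?_
    rw [lm, lm1, lP1]
    have hslope : -4 ≤ logb 2 (z / 2) - logb 2 (1 - z / 2) := by
      have hle : (2 : ℝ) ^ (-4 : ℝ) * (1 - z / 2) ≤ z / 2 := by
        norm_num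
        nlinarith
      have := logb_le_logb_of_le (b := 2) (by norm_num) (by positivity) hle
      rw [logb_mul (by positivity) hz2.ne', logb_rpow (by norm_num) (by norm_num)] at this
      linarith
    have := mul_nonneg (by linarith : 0 ≤ 1 - z - γ)
      (by linarith : 0 ≤ logb 2 (z / 2) - logb 2 (1 - z / 2) + 4)
    unfold binEnt
    linarith

end IsingParams

theorem bellman_equation_solved (a : ℝ) (ha : a ∈ Set.Ioo (0 : ℝ) 1)
    (haroot : a ^ 4 - 5 * a ^ 3 + 6 * a ^ 2 - 4 * a + 1 = 0)
    (hauniq : ∀ x ∈ Set.Ioo (0 : ℝ) 1,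
      x ^ 4 - 5 * x ^ 3 + 6 * x ^ 2 - 4 * x + 1 = 0 → x = a) :
    ∀ z ∈ Set.Icc (0 : ℝ) 1,
      IsGreatest
        {v : ℝ | ∃ δ γ : ℝ, 0 ≤ δ ∧ δ ≤ z ∧ 0 ≤ γ ∧ γ ≤ 1 - z ∧
          v = gObj a (2 * binEnt a / (3 + a)) z δ γ}
        (hStar a (2 * binEnt a / (3 + a)) z + 2 * binEnt a / (3 + a)) := by
  intro z hz
  have h := isingParams_of_root ha haroot
  set ρ := 2 * binEnt a / (3 + a)
  have ha2 : 0 < 1 + a := by linarith [h.lower]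
  rcases lt_or_ge z ((1 - a) / (1 + a)) with hl | hl
  · have hright : 2 * a / (1 + a) ≤ 1 - z := by
      have : (1 - a) / (1 + a) = 1 - 2 * a / (1 + a) := by
        field_simp
        ring
      linarith
    have hg := h.isGreatest_of_right hright (by linarith [hz.1])
    rw [hStar_one_sub ρ h.third_lt] at hg
    convert hg using 1
    ext v
    constructor
    · rintro ⟨δ, γ, hδ, hδz, hγ, hγz, rfl⟩
      exact ⟨γ, δ, hγ, hγz, hδ, by linarith, (gObj_swap ρ h.third_lt z δ γ).symm⟩
    · rintro ⟨δ, γ, hδ, hδz, hγ, hγz, rfl⟩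
      exact ⟨γ, δ, hγ, by linarith, hδ, hδz, gObj_swap ρ h.third_lt z γ δ⟩
  · rcases le_total z (2 * a / (1 + a)) with hm | hr
    · exact h.isGreatest_of_mem_middle hl hm
    · exact h.isGreatest_of_right hr hz.2
end
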